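/- arXiv:1901.06516 — 2 statements merged into one kernel-verified Lean document; each statement's English description precedes it below -/
import Mathlib

section
/- In the interpolating Wigner spike model (prior P_0 supported on [-S,S] with ρ=E[X²], time t∈[0,1], SNR function R_ε(t)≥ε for ε∈[s_n,2s_n], s_n∈(0,1/2]), assume ε↦R_ε(t) is regular (a C¹ diffeomorphism with Jacobian ≥1). With L = (1/n)Σ_{i=1}^n( x_i²/2 - x_iX_i - x_iZ̃_i/(2√R_ε(t)) ) and ⟨-⟩_{t,ε} the interpolating Gibbs bracket, one has ∫_{s_n}^{2s_n} dε E⟨(L - ⟨L⟩_{t,ε})²⟩_{t,ε} ≤ (ρ/n)(1 + (ln 2)/4). -/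
open Finset MeasureTheory ProbabilityTheory

/-- The standard Gaussian measure `N(0,1)` on `ℝ`. -/
noncomputable def stdGauss : Measure ℝ := gaussianReal 0 1

instance : IsProbabilityMeasure stdGauss :=
  inferInstanceAs (IsProbabilityMeasure (gaussianReal 0 1))

/-- Interpolating Hamiltonian of the Wigner spike model:
`H_{t,R}(x;X,Z,Z̃) = (1-t)Σ_{i≤j}( x_i²x_j²/(2n) - x_ix_jX_iX_j/n - x_ix_jZ_ij/√(n(1-t)) )
  + R Σ_i ( x_i²/2 - x_iX_i - x_iZ̃_i/√R )`. -/
noncomputable def Hint (n : ℕ) (t R : ℝ) (X : Fin n → ℝ) (Z : Fin n × Fin n → ℝ)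
    (Zt : Fin n → ℝ) (x : Fin n → ℝ) : ℝ :=
  (1 - t) * ∑ i : Fin n, ∑ j ∈ Finset.univ.filter (fun j => i ≤ j),
      (x i ^ 2 * x j ^ 2 / (2 * n) - x i * x j * X i * X j / n
        - x i * x j * Z (i, j) / Real.sqrt (n * (1 - t)))
    + R * ∑ i : Fin n, (x i ^ 2 / 2 - x i * X i - x i * Zt i / Real.sqrt R)

/-- Gibbs expectation `⟨A⟩_{t,R}` under the interpolating posterior, proportional to
`∏_i dP_0(x_i) e^{-H_{t,R}(x;X,Z,Z̃)}`. -/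
noncomputable def gibbsWS (P0 : Measure ℝ) (n : ℕ) (t R : ℝ) (X : Fin n → ℝ)
    (Z : Fin n × Fin n → ℝ) (Zt : Fin n → ℝ) (A : (Fin n → ℝ) → ℝ) : ℝ :=
  (∫ x : Fin n → ℝ, A x * Real.exp (-Hint n t R X Z Zt x)
      ∂(Measure.pi fun _ : Fin n => P0)) /
  (∫ x : Fin n → ℝ, Real.exp (-Hint n t R X Z Zt x)
      ∂(Measure.pi fun _ : Fin n => P0))

/-- Quenched expectation `E` over `X ∼ P_0^{⊗n}`, `Z ∼ N(0,1)^{⊗n×n}`,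
`Z̃ ∼ N(0,1)^{⊗n}`. -/
noncomputable def EWS (P0 : Measure ℝ) (n : ℕ)
    (F : (Fin n → ℝ) → (Fin n × Fin n → ℝ) → (Fin n → ℝ) → ℝ) : ℝ :=
  ∫ X : Fin n → ℝ,
    (∫ Z : Fin n × Fin n → ℝ,
      (∫ Zt : Fin n → ℝ, F X Z Zt ∂(Measure.pi fun _ : Fin n => stdGauss))
      ∂(Measure.pi fun _ : Fin n × Fin n => stdGauss))
    ∂(Measure.pi fun _ : Fin n => P0)

/-- `L = (1/n) Σ_i ( x_i²/2 - x_iX_i - x_iZ̃_i/(2√R) )`. -/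
noncomputable def Lws (n : ℕ) (R : ℝ) (X Zt x : Fin n → ℝ) : ℝ :=
  (1 / n) * ∑ i : Fin n, (x i ^ 2 / 2 - x i * X i - x i * Zt i / (2 * Real.sqrt R))

/-- The overlap `Q = (1/n) Σ_i x_iX_i`. -/
noncomputable def Qws (n : ℕ) (x X : Fin n → ℝ) : ℝ :=
  (1 / n) * ∑ i : Fin n, x i * X i

/-- Quenched Gibbs average `E⟨L⟩_{t,R}`. -/
noncomputable def ELws (P0 : Measure ℝ) (n : ℕ) (t R : ℝ) : ℝ :=
  EWS P0 n (fun X Z Zt => gibbsWS P0 n t R X Z Zt (fun x => Lws n R X Zt x))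

/-- Quenched Gibbs average `E⟨Q⟩_{t,R}`. -/
noncomputable def EQws (P0 : Measure ℝ) (n : ℕ) (t R : ℝ) : ℝ :=
  EWS P0 n (fun X Z Zt => gibbsWS P0 n t R X Z Zt (fun x => Qws n x X))

/-- The density of the shifted standard Gaussian `N(s,1)` with respect to `N(0,1)`. -/
theorem stdGauss_map_add_const (s : ℝ) :
    stdGauss.map (fun z => z + s)
      = stdGauss.withDensity (fun z => ENNReal.ofReal (Real.exp (s * z - s ^ 2 / 2))) := by
  unfold stdGauss
  rw [gaussianReal_map_add_const, gaussianReal_of_var_ne_zero _ one_ne_zero,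
    gaussianReal_of_var_ne_zero _ one_ne_zero, ← withDensity_mul _ (by fun_prop) (by fun_prop)]
  congr 1
  ext z
  simp only [gaussianPDF, Pi.mul_apply]
  rw [← ENNReal.ofReal_mul (gaussianPDFReal_nonneg _ _ _)]
  congr 1
  simp only [gaussianPDFReal, mul_assoc, ← Real.exp_add]
  congr 2
  simp
  ring

/-- Cameron-Martin formula for the standard Gaussian measure on `ι → ℝ`. -/
theorem pi_stdGauss_map_add_const {ι : Type*} [Fintype ι] (s : ι → ℝ) :
    (Measure.pi fun _ : ι => stdGauss).map (fun z => z + s)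
      = (Measure.pi fun _ : ι => stdGauss).withDensity
        (fun z => ENNReal.ofReal (Real.exp (∑ i, (s i * z i - s i ^ 2 / 2)))) := by
  have hprob (i : ι) : IsProbabilityMeasure (stdGauss.map (fun z => z + s i)) :=
    Measure.isProbabilityMeasure_map (by fun_prop)
  have h1 := Measure.pi_map_pi (μ := fun _ : ι => stdGauss) (f := fun i z => z + s i)
    (fun i => by fun_prop)
  change (Measure.pi fun _ : ι => stdGauss).map (fun z i => z i + s i) = _
  rw [h1]
  refine Measure.pi_eq fun A hA => ?_
  rw [withDensity_apply _ (.univ_pi hA), ← lintegral_indicator (.univ_pi hA)]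
  have hind : iIndepFun (fun i (z : ι → ℝ) => (A i).indicator
      (fun y => ENNReal.ofReal (Real.exp (s i * y - s i ^ 2 / 2))) (z i))
      (Measure.pi fun _ : ι => stdGauss) :=
    iIndepFun_pi (fun i => (Measurable.indicator (by fun_prop) (hA i)).aemeasurable)
  have h2 := lintegral_prod_eq_prod_lintegral_of_indepFun Finset.univ _ hind
    (fun i => (Measurable.indicator (by fun_prop) (hA i)).comp (measurable_pi_apply i))
  calc _ = ∫⁻ z : ι → ℝ, ∏ i, (A i).indicator
        (fun y => ENNReal.ofReal (Real.exp (s i * y - s i ^ 2 / 2))) (z i)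
        ∂(Measure.pi fun _ : ι => stdGauss) := by
        refine lintegral_congr fun z => ?_
        by_cases hz : z ∈ Set.univ.pi A
        · rw [Set.indicator_of_mem hz, Real.exp_sum,
            ENNReal.ofReal_prod_of_nonneg fun i _ => (Real.exp_pos _).le]
          exact Finset.prod_congr rfl fun i _ =>
            (Set.indicator_of_mem (hz i (Set.mem_univ i)) (fun y => ENNReal.ofReal
              (Real.exp (s i * y - s i ^ 2 / 2)))).symm
        · rw [Set.indicator_of_notMem hz]
          simp only [Set.mem_pi, Set.mem_univ, true_imp_iff, not_forall] at hz
          obtain ⟨i, hi⟩ := hz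
          exact (Finset.prod_eq_zero (Finset.mem_univ i) (Set.indicator_of_notMem hi _)).symm
    _ = _ := by
        rw [h2]
        refine Finset.prod_congr rfl fun i _ => ?_
        rw [stdGauss_map_add_const, withDensity_apply _ (hA i), ← lintegral_indicator (hA i)]
        exact ((measurePreserving_eval (fun _ : ι => stdGauss) i).lintegral_comp
          (Measurable.indicator (by fun_prop) (hA i)))

theorem stdGauss_prod_map_rotation {α β : ℝ} (h : α ^ 2 + β ^ 2 = 1) :
    (stdGauss.prod stdGauss).map (fun p => α * p.1 + β * p.2) = stdGauss := by
  have h1 : (stdGauss.prod stdGauss).map (fun p => α * p.1 + β * p.2)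
      = (stdGauss.map (α * ·)) ∗ (stdGauss.map (β * ·)) := by
    rw [Measure.conv, Measure.map_prod_map _ _ (by fun_prop) (by fun_prop),
      Measure.map_map (by fun_prop) (by fun_prop)]
    rfl
  rw [h1]
  unfold stdGauss
  rw [gaussianReal_map_const_mul, gaussianReal_map_const_mul, gaussianReal_conv_gaussianReal]
  congr 1
  · simp
  · ext; simpa using h

/-- Rotation invariance of the standard Gaussian measure on `ι → ℝ`. -/
theorem measurePreserving_stdGauss_rotation {ι : Type*} [Fintype ι] {α β : ℝ}
    (h : α ^ 2 + β ^ 2 = 1) :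
    MeasurePreserving (fun p : (ι → ℝ) × (ι → ℝ) => α • p.1 + β • p.2)
      ((Measure.pi fun _ : ι => stdGauss).prod (Measure.pi fun _ : ι => stdGauss))
      (Measure.pi fun _ : ι => stdGauss) := by
  refine ⟨by fun_prop, ?_⟩
  have h0 := measurePreserving_arrowProdEquivProdArrow ℝ ℝ ι (fun _ => stdGauss) (fun _ => stdGauss)
  have h1 : IsProbabilityMeasure
      ((stdGauss.prod stdGauss).map (fun p : ℝ × ℝ => α * p.1 + β * p.2)) :=
    Measure.isProbabilityMeasure_map (by fun_prop)
  have h2 := Measure.pi_map_pi (μ := fun _ : ι => stdGauss.prod stdGauss)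
    (f := fun _ p => α * p.1 + β * p.2) (fun i => by fun_prop)
  rw [stdGauss_prod_map_rotation h] at h2
  rw [← h0.map_eq, Measure.map_map (by fun_prop) (by fun_prop)]
  exact h2

section Channel

variable {E W : Type*} [MeasurableSpace E] [MeasurableSpace W] {P : Measure E} {γ : Measure W}

/-- The average of `a` under the probability measure proportional to `w · P`. -/
noncomputable def weightedAvg (P : Measure E) (w a : E → ℝ) : ℝ :=
  (∫ x, a x * w x ∂P) / ∫ x, w x ∂P

theorem abs_weightedAvg_le {w a : E → ℝ} {C : ℝ} (hC : 0 ≤ C) (hw : Integrable w P)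
    (hw0 : ∀ x, 0 ≤ w x) (ha : ∀ᵐ x ∂P, |a x| ≤ C) : |weightedAvg P w a| ≤ C := by
  rw [weightedAvg, abs_div, abs_of_nonneg (integral_nonneg (f := w) hw0)]
  refine div_le_of_le_mul₀ (integral_nonneg (f := w) hw0) hC ?_
  have h := norm_integral_le_of_norm_le (f := fun x => a x * w x) (hw.const_mul C) ?_
  · rwa [integral_const_mul] at h
  filter_upwards [ha] with x hx
  rw [Real.norm_eq_abs, abs_mul, abs_of_nonneg (hw0 x)]
  exact mul_le_mul_of_nonneg_right hx (hw0 x)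

theorem measurable_weightedAvg {Ω : Type*} [MeasurableSpace Ω] [SFinite P] {w a : Ω → E → ℝ}
    (hw : Measurable (Function.uncurry w)) (ha : Measurable (Function.uncurry a)) :
    Measurable fun ω => weightedAvg P (w ω) (a ω) := by
  refine Measurable.div ?_ ?_
  · exact (StronglyMeasurable.integral_prod_right (ν := P)
      (f := fun ω x => a ω x * w ω x) (ha.mul hw).stronglyMeasurable).measurable
  · exact (StronglyMeasurable.integral_prod_right (ν := P) (f := w)
      hw.stronglyMeasurable).measurable

/-- Nishimori identity for a channel `T` from the signal and noise `(X, Z)` to the pair made of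
the signal and the observation, with transition density `w` with respect to `γ`. -/
theorem nishimori [IsProbabilityMeasure P] [SFinite γ] {T : E × W → E × W} (hT : Measurable T)
    {w : W → E → ℝ} (hw : Measurable (Function.uncurry w)) (hw0 : ∀ y x, 0 < w y x)
    (hmap : (P.prod γ).map T = (P.prod γ).withDensity (fun p => ENNReal.ofReal (w p.2 p.1)))
    {a : E → ℝ} (ham : Measurable a) {C : ℝ} (hC : 0 ≤ C) (ha : ∀ᵐ x ∂P, |a x| ≤ C)
    {b : W → ℝ} (hbm : Measurable b)
    (hint : Integrable (fun p => b (T p).2) (P.prod γ)) :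
    ∫ p, weightedAvg P (w (T p).2) a * b (T p).2 ∂(P.prod γ)
      = ∫ p, a (T p).1 * b (T p).2 ∂(P.prod γ) := by
  have hwm : Measurable fun p : E × W => w p.2 p.1 := hw.comp measurable_swap
  have key (F : E × W → ℝ) (hF : Measurable F) :
      ∫ p, F (T p) ∂(P.prod γ) = ∫ p, w p.2 p.1 * F p ∂(P.prod γ) := by
    rw [← integral_map (f := F) hT.aemeasurable hF.aestronglyMeasurable, hmap,
      integral_withDensity_eq_integral_toReal_smul (by fun_prop) (by simp)]
    refine integral_congr_ae (.of_forall fun p => ?_)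
    simp [ENNReal.toReal_ofReal (hw0 _ _).le]
  have keyI (F : E × W → ℝ) (hF : Measurable F) :
      Integrable (fun p => F (T p)) (P.prod γ)
        ↔ Integrable (fun p => w p.2 p.1 * F p) (P.prod γ) := by
    change Integrable (F ∘ T) _ ↔ _
    rw [← integrable_map_measure hF.aestronglyMeasurable hT.aemeasurable, hmap,
      integrable_withDensity_iff_integrable_smul' (by fun_prop) (by simp)]
    refine integrable_congr (.of_forall fun p => ?_)
    simp [ENNReal.toReal_ofReal (hw0 _ _).le]
  have hG : Measurable fun y => weightedAvg P (w y) a :=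
    measurable_weightedAvg hw (ham.comp measurable_snd)
  have hG' : Measurable fun p : E × W => weightedAvg P (w p.2) a := hG.comp measurable_snd
  have hI := (keyI (fun p => b p.2) (by fun_prop)).1 hint
  -- for almost every observation, the transition density is integrable wherever `b` is nonzero
  have hI2 : ∀ᵐ y ∂γ, b y = 0 ∨ Integrable (w y) P := by
    filter_upwards [hI.prod_left_ae] with y hy
    by_cases hb : b y = 0
    · exact Or.inl hb
    · right
      have := hy.mul_const (b y)⁻¹
      refine this.congr (.of_forall fun x => ?_)
      simp [hb]
  have hIa : Integrable (fun p : E × W => w p.2 p.1 * (a p.1 * b p.2)) (P.prod γ) := by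
    refine (hI.norm.const_mul C).mono' (by fun_prop) ?_
    filter_upwards [(Measure.quasiMeasurePreserving_fst (μ := P) (ν := γ)).ae ha] with p hp
    rw [norm_mul, norm_mul, norm_mul]
    have := mul_le_mul_of_nonneg_right hp (mul_nonneg (norm_nonneg (w p.2 p.1))
      (norm_nonneg (b p.2)))
    simp only [Real.norm_eq_abs] at *
    linarith
  have hIG : Integrable (fun p : E × W => w p.2 p.1 * (weightedAvg P (w p.2) a * b p.2))
      (P.prod γ) := by
    refine (hI.norm.const_mul C).mono'
      (hwm.mul (hG'.mul (hbm.comp measurable_snd))).aestronglyMeasurable ?_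
    filter_upwards [(Measure.quasiMeasurePreserving_snd (μ := P) (ν := γ)).ae hI2] with p hp
    rcases hp with hp | hp
    · simp [hp]
    · rw [norm_mul, norm_mul, norm_mul]
      have := mul_le_mul_of_nonneg_right
        (abs_weightedAvg_le hC hp (fun x => (hw0 _ x).le) ha)
        (mul_nonneg (norm_nonneg (w p.2 p.1)) (norm_nonneg (b p.2)))
      simp only [Real.norm_eq_abs] at *
      linarith
  rw [key (fun p => a p.1 * b p.2) (by fun_prop),
    key (fun p => weightedAvg P (w p.2) a * b p.2)
      (hG'.mul (hbm.comp measurable_snd)),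
    integral_prod_symm _ hIa, integral_prod_symm _ hIG]
  refine integral_congr_ae ?_
  filter_upwards [hI2] with y hy
  rcases hy with hy | hy
  · simp [hy]
  · have hpos : 0 < ∫ x, w y x ∂P :=
      (integral_pos_iff_support_of_nonneg (fun x => (hw0 y x).le) hy).2 (by
        have : Function.support (w y) = Set.univ := by
          ext x; simp [(hw0 y x).ne']
        simp [this])
    simp only [weightedAvg]
    rw [integral_mul_const]
    have : ∫ x, w y x * (a x * b y) ∂P = (∫ x, a x * w y x ∂P) * b y := by
      rw [← integral_mul_const]
      congr 1; ext x; ring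
    rw [this]
    field_simp

end Channel

theorem prod_map_eq_withDensity {E W : Type*} [MeasurableSpace E] [MeasurableSpace W]
    {P : Measure E} {γ : Measure W} [SFinite P] [SFinite γ] {τ : E → W → W}
    (hτ : Measurable (Function.uncurry τ)) {f : E → W → ENNReal}
    (hf : Measurable (Function.uncurry f)) (h : ∀ x, γ.map (τ x) = γ.withDensity (f x)) :
    (P.prod γ).map (fun p => (p.1, τ p.1 p.2))
      = (P.prod γ).withDensity (fun p => f p.1 p.2) := by
  have hT : Measurable fun p : E × W => (p.1, τ p.1 p.2) := measurable_fst.prodMk hτ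
  ext A hA
  rw [Measure.map_apply hT hA, Measure.prod_apply (hT hA), withDensity_apply _ hA,
    ← lintegral_indicator hA]
  refine Eq.trans ?_ (lintegral_prod _ (hf.indicator hA).aemeasurable).symm
  refine lintegral_congr fun x => ?_
  have hAx : MeasurableSet (Prod.mk x ⁻¹' A) := measurable_prodMk_left hA
  have hτx : Measurable (τ x) := hτ.comp measurable_prodMk_left
  have h1 : Prod.mk x ⁻¹' ((fun p : E × W => (p.1, τ p.1 p.2)) ⁻¹' A)
      = τ x ⁻¹' (Prod.mk x ⁻¹' A) := rfl
  rw [h1, ← Measure.map_apply hτx hAx, h x, withDensity_apply _ hAx, ← lintegral_indicator hAx]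
  rfl

theorem integrable_of_continuous_of_ae_mem_compact {E : Type*} [TopologicalSpace E] [T2Space E]
    [MeasurableSpace E] [OpensMeasurableSpace E] [SecondCountableTopology E] {P : Measure E}
    [IsFiniteMeasure P]
    {K : Set E} (hK : IsCompact K) (hPK : ∀ᵐ x ∂P, x ∈ K) {f : E → ℝ} (hf : Continuous f) :
    Integrable f P := by
  rw [← Measure.restrict_eq_self_of_ae_mem hPK]
  exact hf.continuousOn.integrableOn_compact hK

/-- The product prior `P_0^{⊗n}`. -/
noncomputable abbrev priorPi (P0 : Measure ℝ) (n : ℕ) : Measure (Fin n → ℝ) :=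
  Measure.pi fun _ : Fin n => P0

/-- The observations, or the noises, of the two Gaussian channels. -/
abbrev Obs (n : ℕ) : Type := (Fin n × Fin n → ℝ) × (Fin n → ℝ)

/-- The joint law of the noises `(Z, Z̃)`. -/
noncomputable abbrev noise (n : ℕ) : Measure (Obs n) :=
  (Measure.pi fun _ : Fin n × Fin n => stdGauss).prod (Measure.pi fun _ : Fin n => stdGauss)

/-- The joint law of the signal and the noises. -/
noncomputable abbrev quenched (P0 : Measure ℝ) (n : ℕ) : Measure ((Fin n → ℝ) × Obs n) :=
  (priorPi P0 n).prod (noise n)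

/-- The rank-one signal `c x_i x_j`, `i ≤ j`. -/
noncomputable def spike {n : ℕ} (c : ℝ) (x : Fin n → ℝ) (p : Fin n × Fin n) : ℝ :=
  if p.1 ≤ p.2 then c * (x p.1 * x p.2) else 0

/-- The observations at signal-to-noise parameters `c` (spike channel) and `r` (scalar channel). -/
noncomputable def observe {n : ℕ} (c r : ℝ) (ω : (Fin n → ℝ) × Obs n) : Obs n :=
  ω.2 + (spike c ω.1, r • ω.1)

/-- The likelihood ratio of the signal `x` given the observations `y`. -/
noncomputable def likelihood {n : ℕ} (c r : ℝ) (y : Obs n) (x : Fin n → ℝ) : ℝ :=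
  Real.exp (∑ p, (spike c x p * y.1 p - spike c x p ^ 2 / 2))
    * Real.exp (∑ i, ((r • x) i * y.2 i - (r • x) i ^ 2 / 2))

section Model

variable {n : ℕ} {c r : ℝ}

@[fun_prop]
theorem continuous_spike : Continuous (spike c : (Fin n → ℝ) → Fin n × Fin n → ℝ) := by
  refine continuous_pi fun p => ?_
  unfold spike
  split_ifs <;> fun_prop

@[fun_prop]
theorem continuous_observe :
    Continuous (observe c r : (Fin n → ℝ) × Obs n → Obs n) := by
  unfold observe
  fun_prop

theorem likelihood_pos (y : Obs n) (x : Fin n → ℝ) : 0 < likelihood c r y x :=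
  mul_pos (Real.exp_pos _) (Real.exp_pos _)

theorem continuous_uncurry_likelihood :
    Continuous (Function.uncurry (likelihood c r : Obs n → (Fin n → ℝ) → ℝ)) := by
  have h (p : Fin n × Fin n) : Continuous fun x : Fin n → ℝ => spike c x p :=
    (continuous_apply p).comp continuous_spike
  unfold likelihood Function.uncurry
  fun_prop

theorem continuous_likelihood (y : Obs n) : Continuous (likelihood c r y) :=
  continuous_uncurry_likelihood.comp (by fun_prop : Continuous fun x => (y, x))

theorem map_observe (P0 : Measure ℝ) [IsProbabilityMeasure P0] (c r : ℝ) :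
    (quenched P0 n).map (fun ω => (ω.1, observe c r ω))
      = (quenched P0 n).withDensity
        (fun p => ENNReal.ofReal (likelihood c r p.2 p.1)) := by
  refine prod_map_eq_withDensity (τ := fun x z => observe c r (x, z))
    (f := fun x y => ENNReal.ofReal (likelihood c r y x)) ?_ ?_ fun x => ?_
  · exact continuous_observe.measurable
  · have h : Continuous fun p : (Fin n → ℝ) × Obs n => likelihood c r p.2 p.1 :=
      continuous_uncurry_likelihood.comp continuous_swap
    exact h.measurable.ennreal_ofReal
  · change (noise n).map (Prod.map (fun z => z + spike c x) (fun z => z + r • x)) = _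
    rw [← Measure.map_prod_map _ _ (by fun_prop) (by fun_prop), pi_stdGauss_map_add_const,
      pi_stdGauss_map_add_const, prod_withDensity (by fun_prop) (by fun_prop)]
    congr 1
    ext z
    rw [← ENNReal.ofReal_mul (Real.exp_pos _).le]
    rfl

theorem exp_neg_Hint {t R : ℝ} (ht : t ≤ 1) (hn : n ≠ 0) (hR : 0 < R) (ω : (Fin n → ℝ) × Obs n)
    (x : Fin n → ℝ) :
    Real.exp (-Hint n t R ω.1 ω.2.1 ω.2.2 x)
      = likelihood (√((1 - t) / n)) (√R) (observe (√((1 - t) / n)) (√R) ω) x := by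
  rw [likelihood, ← Real.exp_add]
  congr 1
  rw [Hint, neg_add, Fintype.sum_prod_type]
  congr 1
  · rw [← mul_neg, ← Finset.sum_neg_distrib, Finset.mul_sum]
    refine Finset.sum_congr rfl fun i _ => ?_
    rw [← Finset.sum_neg_distrib, Finset.mul_sum, Finset.sum_filter]
    refine Finset.sum_congr rfl fun j _ => ?_
    by_cases hij : i ≤ j
    · have h1 : √((1 - t) / n) ^ 2 = (1 - t) / n :=
        Real.sq_sqrt (div_nonneg (by linarith) (by positivity))
      have h2 : (1 - t) / √(n * (1 - t)) = √((1 - t) / n) := by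
        rw [Real.sqrt_mul (by positivity), Real.sqrt_div (by linarith), mul_comm, ← div_div,
          Real.div_sqrt]
      simp only [observe, spike, hij, if_true, Prod.fst_add, Pi.add_apply]
      generalize hc : √((1 - t) / n) = c at *
      rw [show (1 - t) * -(x i ^ 2 * x j ^ 2 / (2 * n) - x i * x j * ω.1 i * ω.1 j / n
        - x i * x j * ω.2.1 (i, j) / √(n * (1 - t)))
        = -((1 - t) / n) * (x i ^ 2 * x j ^ 2 / 2 - x i * x j * ω.1 i * ω.1 j)
        + ((1 - t) / √(n * (1 - t))) * x i * x j * ω.2.1 (i, j) by field_simp; ring]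
      rw [h2, ← h1]
      ring
    · simp [spike, hij]
  · rw [← mul_neg, ← Finset.sum_neg_distrib, Finset.mul_sum]
    refine Finset.sum_congr rfl fun i _ => ?_
    have key (r a b z : ℝ) (hr : r ≠ 0) :
        r ^ 2 * -(a ^ 2 / 2 - a * b - a * z / r) = r * a * (z + r * b) - (r * a) ^ 2 / 2 := by
      field_simp
      ring
    simpa [observe, Real.sq_sqrt hR.le] using
      key (√R) (x i) (ω.1 i) (ω.2.2 i) (Real.sqrt_pos.2 hR).ne'

theorem gibbsWS_eq_weightedAvg (P0 : Measure ℝ) {t R : ℝ} (ht : t ≤ 1) (hn : n ≠ 0) (hR : 0 < R)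
    (ω : (Fin n → ℝ) × Obs n) (A : (Fin n → ℝ) → ℝ) :
    gibbsWS P0 n t R ω.1 ω.2.1 ω.2.2 A = weightedAvg (priorPi P0 n)
      (likelihood (√((1 - t) / n)) (√R) (observe (√((1 - t) / n)) (√R) ω)) A := by
  simp only [gibbsWS, weightedAvg, exp_neg_Hint ht hn hR]

end Model

theorem measurePreserving_rotate_noise (P0 : Measure ℝ) [IsProbabilityMeasure P0] {n : ℕ}
    {α β : ℝ} (h : α ^ 2 + β ^ 2 = 1) :
    MeasurePreserving
      (fun p : ((Fin n → ℝ) × Obs n) × (Fin n → ℝ) =>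
        ((p.1.1, (p.1.2.1, α • p.1.2.2 + β • p.2)) : (Fin n → ℝ) × Obs n))
      ((quenched P0 n).prod (Measure.pi fun _ : Fin n => stdGauss)) (quenched P0 n) := by
  have h1 := measurePreserving_prodAssoc (priorPi P0 n) (noise n)
    (Measure.pi fun _ : Fin n => stdGauss)
  have h2 := measurePreserving_prodAssoc (Measure.pi fun _ : Fin n × Fin n => stdGauss)
    (Measure.pi fun _ : Fin n => stdGauss) (Measure.pi fun _ : Fin n => stdGauss)
  have h3 := (MeasurePreserving.id (Measure.pi fun _ : Fin n × Fin n => stdGauss)).prod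
    (measurePreserving_stdGauss_rotation (ι := Fin n) h)
  exact ((MeasurePreserving.id (priorPi P0 n)).prod (h3.comp h2)).comp h1

theorem integrable_mul_of_memLp {Ω : Type*} [MeasurableSpace Ω] {μ : Measure Ω} {f g : Ω → ℝ}
    (hf : MemLp f 2 μ) (hg : MemLp g 2 μ) : Integrable (fun ω => f ω * g ω) μ :=
  hf.integrable_mul hg

section Overlap

variable {P0 : Measure ℝ} [IsProbabilityMeasure P0] {S : ℝ} {n : ℕ}

theorem ae_priorPi_abs_le (hsupp : ∀ᵐ x ∂P0, |x| ≤ S) :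
    ∀ᵐ x ∂(priorPi P0 n), ∀ i, |x i| ≤ S :=
  ae_all_iff.2 fun i =>
    (measurePreserving_eval (fun _ : Fin n => P0) i).quasiMeasurePreserving.ae hsupp

theorem integrable_priorPi_of_continuous (hsupp : ∀ᵐ x ∂P0, |x| ≤ S) {f : (Fin n → ℝ) → ℝ}
    (hf : Continuous f) : Integrable f (priorPi P0 n) := by
  refine integrable_of_continuous_of_ae_mem_compact
    (isCompact_univ_pi fun _ : Fin n => isCompact_Icc (a := -S) (b := S)) ?_ hf
  filter_upwards [ae_priorPi_abs_le hsupp] with x hx i _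
  exact abs_le.1 (hx i)

/-- The posterior mean of `x_i`. -/
noncomputable def postMean (P0 : Measure ℝ) {n : ℕ} (c r : ℝ) (i : Fin n) (y : Obs n) : ℝ :=
  weightedAvg (priorPi P0 n) (likelihood c r y) fun x => x i

/-- The quenched average of the overlap of coordinate `i`. -/
noncomputable def overlap (P0 : Measure ℝ) {n : ℕ} (c r : ℝ) (i : Fin n) : ℝ :=
  ∫ ω, postMean P0 c r i (observe c r ω) ^ 2 ∂(quenched P0 n)

variable {c r : ℝ} {i : Fin n}

theorem abs_weightedAvg_likelihood_le (hsupp : ∀ᵐ x ∂P0, |x| ≤ S) {a : (Fin n → ℝ) → ℝ}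
    {C : ℝ} (hC : 0 ≤ C) (ha : ∀ᵐ x ∂(priorPi P0 n), |a x| ≤ C) (y : Obs n) :
    |weightedAvg (priorPi P0 n) (likelihood c r y) a| ≤ C :=
  abs_weightedAvg_le hC (integrable_priorPi_of_continuous hsupp (continuous_likelihood y))
    (fun x => (likelihood_pos y x).le) ha

theorem measurable_postMean : Measurable (postMean P0 c r i) :=
  measurable_weightedAvg (continuous_uncurry_likelihood.measurable)
    (a := fun _ x => x i) (by fun_prop)

theorem abs_postMean_le (hS : 0 ≤ S) (hsupp : ∀ᵐ x ∂P0, |x| ≤ S) (y : Obs n) :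
    |postMean P0 c r i y| ≤ S :=
  abs_weightedAvg_likelihood_le hsupp hS ((ae_priorPi_abs_le hsupp).mono fun _ h => h i) y

theorem nishimori_observe {a : (Fin n → ℝ) → ℝ}
    (ham : Measurable a) {C : ℝ} (hC : 0 ≤ C) (ha : ∀ᵐ x ∂(priorPi P0 n), |a x| ≤ C)
    {b : Obs n → ℝ} (hbm : Measurable b)
    (hint : Integrable (fun ω => b (observe c r ω)) (quenched P0 n)) :
    ∫ ω, weightedAvg (priorPi P0 n) (likelihood c r (observe c r ω)) a * b (observe c r ω)
        ∂(quenched P0 n)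
      = ∫ ω, a ω.1 * b (observe c r ω) ∂(quenched P0 n) :=
  nishimori (T := fun ω => (ω.1, observe c r ω))
    (measurable_fst.prodMk continuous_observe.measurable)
    continuous_uncurry_likelihood.measurable likelihood_pos (map_observe P0 c r) ham hC ha hbm hint

theorem ae_quenched_signal_le (hsupp : ∀ᵐ x ∂P0, |x| ≤ S) :
    ∀ᵐ ω ∂(quenched P0 n), ∀ i, |ω.1 i| ≤ S :=
  Measure.quasiMeasurePreserving_fst.ae (ae_priorPi_abs_le hsupp)

theorem memLp_signal (hsupp : ∀ᵐ x ∂P0, |x| ≤ S) :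
    MemLp (fun ω : (Fin n → ℝ) × Obs n => ω.1 i) 2 (quenched P0 n) :=
  MemLp.of_bound (by fun_prop) S ((ae_quenched_signal_le hsupp).mono fun _ h => h i)

theorem memLp_postMean (hS : 0 ≤ S) (hsupp : ∀ᵐ x ∂P0, |x| ≤ S) {Ω : Type*} [MeasurableSpace Ω]
    {μ : Measure Ω} [IsFiniteMeasure μ] {Y : Ω → Obs n} (hY : Measurable Y) :
    MemLp (fun ω => postMean P0 c r i (Y ω)) 2 μ :=
  MemLp.of_bound (measurable_postMean.comp hY).aestronglyMeasurable S
    (.of_forall fun _ => abs_postMean_le hS hsupp _)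

theorem memLp_postMean_observe (hS : 0 ≤ S) (hsupp : ∀ᵐ x ∂P0, |x| ≤ S) :
    MemLp (fun ω => postMean P0 c r i (observe c r ω)) 2 (quenched P0 n) :=
  memLp_postMean hS hsupp continuous_observe.measurable

theorem memLp_noise :
    MemLp (fun ω : (Fin n → ℝ) × Obs n => ω.2.2 i) 2 (quenched P0 n) := by
  have h : MemLp id 2 stdGauss := memLp_id_gaussianReal 2
  have h1 : MeasurePreserving (fun ω : (Fin n → ℝ) × Obs n => ω.2.2 i) (quenched P0 n) stdGauss :=
    (measurePreserving_eval (fun _ : Fin n => stdGauss) i).comp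
      (measurePreserving_snd.comp measurePreserving_snd)
  exact h.comp_measurePreserving h1

theorem integral_noise_mul_signal :
    ∫ ω, ω.2.2 i * ω.1 i ∂(quenched P0 n) = 0 := by
  have h1 : ∫ ω, ω.1 i * ω.2.2 i ∂(quenched P0 n)
      = (∫ x, x i ∂(priorPi P0 n)) * ∫ z, z.2 i ∂(noise n) :=
    integral_prod_mul (fun x : Fin n → ℝ => x i) (fun z : Obs n => z.2 i)
  have h2 : MeasurePreserving (fun z : Obs n => z.2 i) (noise n) stdGauss :=
    (measurePreserving_eval (fun _ : Fin n => stdGauss) i).comp measurePreserving_snd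
  have h3 : ∫ z, z.2 i ∂(noise n) = 0 := by
    have := integral_map (μ := noise n) (f := fun y : ℝ => y) h2.measurable.aemeasurable
      (by fun_prop)
    rw [← this, h2.map_eq]
    exact integral_id_gaussianReal
  simp_rw [mul_comm (_ : ℝ) (_ : ℝ)] at h1 ⊢
  simpa [h3] using h1

theorem integral_signal_sq :
    ∫ ω, ω.1 i ^ 2 ∂(quenched P0 n) = ∫ x, x ^ 2 ∂P0 := by
  have h2 : MeasurePreserving (fun ω : (Fin n → ℝ) × Obs n => ω.1 i) (quenched P0 n) P0 :=
    (measurePreserving_eval (fun _ : Fin n => P0) i).comp measurePreserving_fst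
  rw [← integral_map (μ := quenched P0 n) (f := fun y : ℝ => y ^ 2) h2.measurable.aemeasurable
    (by fun_prop), h2.map_eq]

theorem integral_signal_mul_postMean (hS : 0 ≤ S) (hsupp : ∀ᵐ x ∂P0, |x| ≤ S) :
    ∫ ω, ω.1 i * postMean P0 c r i (observe c r ω) ∂(quenched P0 n) = overlap P0 c r i := by
  rw [overlap, ← nishimori_observe (by fun_prop) hS
    ((ae_priorPi_abs_le hsupp).mono fun _ h => h i) measurable_postMean
    ((memLp_postMean_observe hS hsupp).integrable one_le_two)]
  simp only [sq, postMean]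

theorem integral_weightedAvg_sq (hsupp : ∀ᵐ x ∂P0, |x| ≤ S) :
    ∫ ω, weightedAvg (priorPi P0 n) (likelihood c r (observe c r ω)) (fun x => x i ^ 2)
      ∂(quenched P0 n) = ∫ x, x ^ 2 ∂P0 := by
  have h := nishimori_observe (c := c) (r := r) (a := fun x : Fin n → ℝ => x i ^ 2)
    (b := fun _ => 1) (C := S ^ 2) (by fun_prop) (sq_nonneg S)
    ((ae_priorPi_abs_le hsupp).mono fun x h => by
      rw [abs_pow]; exact pow_le_pow_left₀ (abs_nonneg _) (h i) 2) measurable_const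
    (integrable_const _)
  simpa [integral_signal_sq] using h

theorem integral_noise_mul_postMean (hS : 0 ≤ S) (hsupp : ∀ᵐ x ∂P0, |x| ≤ S) :
    ∫ ω, ω.2.2 i * postMean P0 c r i (observe c r ω) ∂(quenched P0 n)
      = r * (∫ x, x ^ 2 ∂P0 - overlap P0 c r i) := by
  have hm := memLp_postMean_observe (n := n) (c := c) (r := r) (i := i) hS hsupp
  have hX := memLp_signal (n := n) (i := i) hsupp
  have hZ := memLp_noise (P0 := P0) (n := n) (i := i)
  have hy (ω : (Fin n → ℝ) × Obs n) : (observe c r ω).2 i = ω.2.2 i + r * ω.1 i := rfl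
  have hYint : Integrable (fun ω => (observe c r ω).2 i) (quenched P0 n) :=
    (hZ.integrable one_le_two).add ((hX.integrable one_le_two).const_mul r)
  have h := nishimori_observe (by fun_prop) hS
    ((ae_priorPi_abs_le hsupp).mono fun _ h => h i) (b := fun y : Obs n => y.2 i) (by fun_prop)
    hYint
  simp only [hy, mul_add] at h
  change ∫ ω, (postMean P0 c r i (observe c r ω) * ω.2.2 i
    + postMean P0 c r i (observe c r ω) * (r * ω.1 i)) ∂(quenched P0 n) = _ at h
  rw [integral_add ((integrable_mul_of_memLp hm hZ)) (integrable_mul_of_memLp hm (hX.const_mul r)),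
    integral_add (integrable_mul_of_memLp hX hZ) (integrable_mul_of_memLp hX (hX.const_mul r))] at h
  have e1 : ∫ ω, ω.2.2 i * postMean P0 c r i (observe c r ω) ∂(quenched P0 n)
      = ∫ ω, postMean P0 c r i (observe c r ω) * ω.2.2 i ∂(quenched P0 n) := by
    congr 1; ext ω; exact mul_comm _ _
  have e2 : ∫ ω, postMean P0 c r i (observe c r ω) * (r * ω.1 i) ∂(quenched P0 n)
      = r * overlap P0 c r i := by
    rw [← integral_signal_mul_postMean hS hsupp, ← integral_const_mul]
    congr 1; ext ω; ring
  have e3 : ∫ ω, ω.1 i * ω.2.2 i ∂(quenched P0 n) = 0 := by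
    rw [← integral_noise_mul_signal (P0 := P0) (i := i)]
    congr 1; ext ω; exact mul_comm _ _
  have e4 : ∫ ω, ω.1 i * (r * ω.1 i) ∂(quenched P0 n) = r * ∫ x, x ^ 2 ∂P0 := by
    rw [← integral_signal_sq (n := n) (i := i), ← integral_const_mul]
    congr 1; ext ω; ring
  rw [e1]
  rw [e2, e3, e4] at h
  linarith

omit [IsProbabilityMeasure P0] in
theorem overlap_nonneg : 0 ≤ overlap P0 c r i :=
  integral_nonneg fun _ => sq_nonneg _

/-- Optimality of the posterior mean among all estimators of the signal. -/
theorem two_mul_integral_sub_le_overlap (hS : 0 ≤ S) (hsupp : ∀ᵐ x ∂P0, |x| ≤ S)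
    {b : Obs n → ℝ} (hb : Measurable b)
    (hbL : MemLp (fun ω => b (observe c r ω)) 2 (quenched P0 n)) :
    ∫ ω, (2 * (ω.1 i * b (observe c r ω)) - b (observe c r ω) ^ 2) ∂(quenched P0 n)
      ≤ overlap P0 c r i := by
  have hm := memLp_postMean_observe (n := n) (c := c) (r := r) (i := i) hS hsupp
  have hX := memLp_signal (n := n) (i := i) hsupp
  have h := nishimori_observe (by fun_prop) hS
    ((ae_priorPi_abs_le hsupp).mono fun _ h => h i) hb (hbL.integrable one_le_two)
  rw [integral_sub ((integrable_mul_of_memLp hX hbL).const_mul 2) hbL.integrable_sq,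
    integral_const_mul,
    ← h, ← integral_const_mul, ← integral_sub _ hbL.integrable_sq]
  · refine integral_mono ?_ hm.integrable_sq fun ω => ?_
    · exact ((integrable_mul_of_memLp hm hbL).const_mul 2).sub hbL.integrable_sq
    · have := sq_nonneg (postMean P0 c r i (observe c r ω) - b (observe c r ω))
      simp only [postMean] at *
      linarith
  · exact (integrable_mul_of_memLp hm hbL).const_mul 2

theorem overlap_le (hS : 0 ≤ S) (hsupp : ∀ᵐ x ∂P0, |x| ≤ S) :
    overlap P0 c r i ≤ ∫ x, x ^ 2 ∂P0 := by
  have hm := memLp_postMean_observe (n := n) (c := c) (r := r) (i := i) hS hsupp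
  have hX := memLp_signal (n := n) (i := i) hsupp
  have h : 0 ≤ ∫ ω, (ω.1 i - postMean P0 c r i (observe c r ω)) ^ 2 ∂(quenched P0 n) :=
    integral_nonneg fun _ => sq_nonneg _
  simp only [sub_sq, mul_assoc] at h
  rw [integral_add (f := fun ω : (Fin n → ℝ) × Obs n => ω.1 i ^ 2
      - 2 * (ω.1 i * postMean P0 c r i (observe c r ω)))
      (hX.integrable_sq.sub ((integrable_mul_of_memLp hX hm).const_mul 2)) hm.integrable_sq,
    integral_sub hX.integrable_sq ((integrable_mul_of_memLp hX hm).const_mul 2), integral_const_mul,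
    integral_signal_mul_postMean hS hsupp, integral_signal_sq] at h
  change 0 ≤ _ + overlap P0 c r i at h
  linarith

theorem overlap_mono (hS : 0 ≤ S) (hsupp : ∀ᵐ x ∂P0, |x| ≤ S) {r₁ r₂ : ℝ} (h1 : 0 < r₁)
    (h12 : r₁ ≤ r₂) : overlap P0 c r₁ i ≤ overlap P0 c r₂ i := by
  have h2 : 0 < r₂ := h1.trans_le h12
  set α := r₁ / r₂ with hα
  set β := √(1 - α ^ 2) with hβ
  have hα1 : α ^ 2 ≤ 1 := pow_le_one₀ (by positivity) ((div_le_one h2).2 h12)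
  have hαβ : α ^ 2 + β ^ 2 = 1 := by rw [hβ, Real.sq_sqrt (by linarith)]; ring
  have hrot := measurePreserving_rotate_noise P0 (n := n) hαβ
  set γ : Measure (Fin n → ℝ) := Measure.pi fun _ : Fin n => stdGauss with hγ
  set Ψ := (fun p : ((Fin n → ℝ) × Obs n) × (Fin n → ℝ) =>
        ((p.1.1, (p.1.2.1, α • p.1.2.2 + β • p.2)) : (Fin n → ℝ) × Obs n)) with hΨ
  let f : (Fin n → ℝ) × Obs n → ℝ := fun ω =>
    2 * (ω.1 i * postMean P0 c r₁ i (observe c r₁ ω)) - postMean P0 c r₁ i (observe c r₁ ω) ^ 2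
  have hm := memLp_postMean_observe (n := n) (c := c) (r := r₁) (i := i) hS hsupp
  have hX := memLp_signal (n := n) (i := i) hsupp
  have hf : Integrable f (quenched P0 n) :=
    ((integrable_mul_of_memLp hX hm).const_mul 2).sub hm.integrable_sq
  have hf1 : ∫ ω, f ω ∂(quenched P0 n) = overlap P0 c r₁ i := by
    change ∫ ω, (2 * (ω.1 i * postMean P0 c r₁ i (observe c r₁ ω))
      - postMean P0 c r₁ i (observe c r₁ ω) ^ 2) ∂(quenched P0 n) = _
    rw [integral_sub ((integrable_mul_of_memLp hX hm).const_mul 2) hm.integrable_sq,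
      integral_const_mul,
      integral_signal_mul_postMean hS hsupp]
    change 2 * _ - overlap P0 c r₁ i = _
    ring
  have hfΨ : Integrable (fun p => f (Ψ p)) ((quenched P0 n).prod γ) :=
    hrot.integrable_comp_of_integrable hf
  have hf2 : ∫ p, f (Ψ p) ∂((quenched P0 n).prod γ) = overlap P0 c r₁ i := by
    rw [← hf1, ← hrot.map_eq, integral_map hrot.measurable.aemeasurable]
    · rw [hrot.map_eq]
    rw [hrot.map_eq]
    exact hf.aestronglyMeasurable
  have hbound (w : Fin n → ℝ) : ∫ ω, f (Ψ (ω, w)) ∂(quenched P0 n) ≤ overlap P0 c r₂ i := by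
    let b : Obs n → ℝ := fun y => postMean P0 c r₁ i (y.1, α • y.2 + β • w)
    have hb : Measurable b := measurable_postMean.comp (by fun_prop)
    have hbL : MemLp (fun ω => b (observe c r₂ ω)) 2 (quenched P0 n) :=
      memLp_postMean hS hsupp (Measurable.comp (g := fun y : Obs n => (y.1, α • y.2 + β • w))
        (by fun_prop) continuous_observe.measurable)
    refine le_of_eq_of_le ?_ (two_mul_integral_sub_le_overlap hS hsupp hb hbL)
    congr 1
    ext ω
    have : observe c r₁ (Ψ (ω, w)) = ((observe c r₂ ω).1, α • (observe c r₂ ω).2 + β • w) := by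
      have hαr : α * r₂ = r₁ := div_mul_cancel₀ _ h2.ne'
      ext j
      · rfl
      · simp only [observe, hΨ, Prod.snd_add, Pi.add_apply, Pi.smul_apply, smul_eq_mul, ← hαr]
        ring
    simp only [f, b, this]
    rfl
  rw [← hf2, integral_prod_symm _ hfΨ]
  calc _ ≤ ∫ _, overlap P0 c r₂ i ∂γ :=
        integral_mono hfΨ.integral_prod_right (integrable_const _) hbound
    _ = _ := by simp [hγ]

end Overlap

section Family

open Topology

variable {E : Type*} [TopologicalSpace E] [T2Space E] [SecondCountableTopology E]
  [MeasurableSpace E] [OpensMeasurableSpace E] {P : Measure E} {K : Set E}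

theorem hasDerivAt_integral_of_ae_mem_compact [IsFiniteMeasure P] (hK : IsCompact K)
    (hPK : ∀ᵐ x ∂P, x ∈ K) {f f' : ℝ → E → ℝ} (hf : ∀ R, Continuous (f R))
    (hf' : ContinuousOn (Function.uncurry f') (Set.Ioi 0 ×ˢ Set.univ))
    (hd : ∀ R > 0, ∀ x, HasDerivAt (fun R => f R x) (f' R x) R) {R : ℝ} (hR : 0 < R) :
    HasDerivAt (fun R => ∫ x, f R x ∂P) (∫ x, f' R x ∂P) R := by
  have hpos : ∀ r ∈ Metric.closedBall R (R / 2), 0 < r := by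
    intro r hr
    rw [Metric.mem_closedBall, Real.dist_eq, abs_le] at hr
    linarith [hr.1]
  obtain ⟨C, hC⟩ := ((isCompact_closedBall R (R / 2)).prod hK).exists_bound_of_continuousOn
    (hf'.mono (Set.prod_mono (fun r hr => hpos r hr) (Set.subset_univ K)))
  have hf'R : Continuous (f' R) := by
    have : ContinuousOn (fun x => Function.uncurry f' (R, x)) Set.univ :=
      hf'.comp (by fun_prop) (fun x _ => ⟨hR, Set.mem_univ x⟩)
    exact continuousOn_univ.1 this
  refine (hasDerivAt_integral_of_dominated_loc_of_deriv_le (bound := fun _ => C)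
    (Metric.closedBall_mem_nhds R (half_pos hR)) ?_ ?_ ?_ ?_ (integrable_const C) ?_).2
  · exact .of_forall fun r => (hf r).aestronglyMeasurable
  · exact integrable_of_continuous_of_ae_mem_compact hK hPK (hf R)
  · exact hf'R.aestronglyMeasurable
  · filter_upwards [hPK] with x hx r hr
    exact hC (r, x) ⟨hr, hx⟩
  · exact .of_forall fun x r hr => hd r (hpos r hr) x

/-- Derivative of the Gibbs average of the energy `∂_R H_R`, where
`H_R = -a + R B - √R C`. -/
theorem hasDerivAt_weightedAvg_energy [IsProbabilityMeasure P] (hK : IsCompact K)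
    (hPK : ∀ᵐ x ∂P, x ∈ K) {a B C : E → ℝ} (ha : Continuous a) (hB : Continuous B)
    (hC : Continuous C) {w : ℝ → E → ℝ}
    (hw : ∀ R > 0, w R = fun x => Real.exp (a x - R * B x + √R * C x)) {R : ℝ} (hR : 0 < R) :
    HasDerivAt (fun R => weightedAvg P (w R) fun x => B x - C x / (2 * √R))
      (weightedAvg P (w R) C / (4 * R * √R)
        - (weightedAvg P (w R) (fun x => (B x - C x / (2 * √R)) ^ 2)
          - weightedAvg P (w R) (fun x => B x - C x / (2 * √R)) ^ 2)) R := by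
  let e : ℝ → E → ℝ := fun R x => Real.exp (a x - R * B x + √R * C x)
  let l : ℝ → E → ℝ := fun R x => B x - C x / (2 * √R)
  have he (R : ℝ) : Continuous (e R) := by fun_prop
  have hl (R : ℝ) : Continuous (l R) := by fun_prop
  have hed (R : ℝ) (hR : 0 < R) (x : E) : HasDerivAt (fun R => e R x) (-(l R x * e R x)) R := by
    have h1 := ((((hasDerivAt_id R).mul_const (B x)).const_sub (a x)).add
      ((Real.hasDerivAt_sqrt hR.ne').mul_const (C x))).exp
    refine h1.congr_deriv ?_
    simp only [e, l, id, Pi.add_apply]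
    ring
  have hld (R : ℝ) (hR : 0 < R) (x : E) :
      HasDerivAt (fun R => l R x) (C x / (4 * R * √R)) R := by
    have h0 : √R ≠ 0 := (Real.sqrt_pos.2 hR).ne'
    have h1 := (((hasDerivAt_const R (C x)).div ((Real.hasDerivAt_sqrt hR.ne').const_mul 2)
      (by positivity)).const_sub (B x))
    refine h1.congr_deriv ?_
    have h2 : √R ^ 2 = R := Real.sq_sqrt hR.le
    field_simp
    rw [h2]
    ring
  have hsqrt : ∀ p ∈ Set.Ioi (0 : ℝ) ×ˢ (Set.univ : Set E), √p.1 ≠ 0 :=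
    fun p hp => (Real.sqrt_pos.2 hp.1).ne'
  have hec : Continuous fun p : ℝ × E => e p.1 p.2 := by fun_prop
  have hlc : ContinuousOn (fun p : ℝ × E => l p.1 p.2) (Set.Ioi 0 ×ˢ Set.univ) := by
    refine (by fun_prop : Continuous fun p : ℝ × E => B p.2).continuousOn.sub
      (ContinuousOn.div (by fun_prop) (by fun_prop) fun p hp => ?_)
    exact mul_ne_zero two_ne_zero (hsqrt p hp)
  have hD := hasDerivAt_integral_of_ae_mem_compact hK hPK he
    (f' := fun R x => -(l R x * e R x)) (hlc.mul hec.continuousOn).neg hed hR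
  have hN := hasDerivAt_integral_of_ae_mem_compact hK hPK
    (f := fun R x => l R x * e R x)
    (f' := fun R x => C x / (4 * R * √R) * e R x + l R x * -(l R x * e R x))
    (fun R => (hl R).mul (he R))
    (((ContinuousOn.div (by fun_prop) (by fun_prop) fun p hp =>
      mul_ne_zero (mul_ne_zero four_ne_zero hp.1.ne') (hsqrt p hp)).mul hec.continuousOn).add
      (hlc.mul (hlc.mul hec.continuousOn).neg))
    (fun R hR x => (hld R hR x).mul (hed R hR x)) hR
  have hint {f : E → ℝ} (hf : Continuous f) : Integrable f P :=
    integrable_of_continuous_of_ae_mem_compact hK hPK hf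
  have hDpos : 0 < ∫ x, e R x ∂P := integral_exp_pos (hint (he R))
  have hquot := hN.div hD hDpos.ne'
  have heq : (fun R => weightedAvg P (w R) (l R)) =ᶠ[𝓝 R]
      (fun R => ∫ x, l R x * e R x ∂P) / fun R => ∫ x, e R x ∂P := by
    filter_upwards [lt_mem_nhds hR] with r hr
    simp only [weightedAvg, hw r hr, Pi.div_apply]
    rfl
  refine (hquot.congr_of_eventuallyEq heq).congr_deriv ?_
  have e1 : ∫ x, (C x / (4 * R * √R) * e R x + l R x * -(l R x * e R x)) ∂P
      = (∫ x, C x * e R x ∂P) / (4 * R * √R) - ∫ x, l R x ^ 2 * e R x ∂P := by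
    rw [← integral_div, ← integral_sub ((hint (by fun_prop)).div_const _) (hint (by fun_prop))]
    congr 1; ext x; ring
  rw [e1, integral_neg]
  change _ = (∫ x, C x * w R x ∂P) / (∫ x, w R x ∂P) / (4 * R * √R)
    - ((∫ x, l R x ^ 2 * w R x ∂P) / (∫ x, w R x ∂P)
      - ((∫ x, l R x * w R x ∂P) / (∫ x, w R x ∂P)) ^ 2)
  rw [show w R = e R from hw R hR]
  have h0 : √R ≠ 0 := (Real.sqrt_pos.2 hR).ne'
  field_simp
  ring

end Family

section WeightedAvg

variable {E ι : Type*} [MeasurableSpace E] {P : Measure E} {w : E → ℝ}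

theorem weightedAvg_sum {s : Finset ι} {a : ι → E → ℝ}
    (ha : ∀ i ∈ s, Integrable (fun x => a i x * w x) P) :
    weightedAvg P w (fun x => ∑ i ∈ s, a i x) = ∑ i ∈ s, weightedAvg P w (a i) := by
  simp only [weightedAvg, Finset.sum_mul]
  rw [integral_finsetSum s ha, Finset.sum_div]

theorem weightedAvg_sub {a b : E → ℝ} (ha : Integrable (fun x => a x * w x) P)
    (hb : Integrable (fun x => b x * w x) P) :
    weightedAvg P w (fun x => a x - b x) = weightedAvg P w a - weightedAvg P w b := by
  simp only [weightedAvg, sub_mul]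
  rw [integral_sub ha hb, sub_div]

theorem weightedAvg_const_mul (k : ℝ) (a : E → ℝ) :
    weightedAvg P w (fun x => k * a x) = k * weightedAvg P w a := by
  simp only [weightedAvg, mul_assoc, integral_const_mul, mul_div_assoc]

theorem weightedAvg_mul_const (k : ℝ) (a : E → ℝ) :
    weightedAvg P w (fun x => a x * k) = weightedAvg P w a * k := by
  simp only [mul_comm _ k, weightedAvg_const_mul]

theorem weightedAvg_const (k : ℝ) (hw : ∫ x, w x ∂P ≠ 0) : weightedAvg P w (fun _ => k) = k := by
  rw [weightedAvg, integral_const_mul, mul_div_cancel_right₀ _ hw]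

theorem weightedAvg_variance {a : E → ℝ} (h0 : ∫ x, w x ∂P ≠ 0) (hw : Integrable w P)
    (ha : Integrable (fun x => a x * w x) P) (ha2 : Integrable (fun x => a x ^ 2 * w x) P) :
    weightedAvg P w (fun x => (a x - weightedAvg P w a) ^ 2)
      = weightedAvg P w (fun x => a x ^ 2) - weightedAvg P w a ^ 2 := by
  set m := weightedAvg P w a with hm
  have e : (fun x => (a x - m) ^ 2) = fun x => a x ^ 2 - (2 * m * a x - m ^ 2) := by
    ext x; ring
  have h1 : Integrable (fun x => 2 * m * a x * w x) P := by
    simpa only [mul_assoc] using (ha.const_mul m).const_mul 2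
  have h2 : Integrable (fun x => m ^ 2 * w x) P := hw.const_mul _
  rw [e, weightedAvg_sub ha2 (by simp only [sub_mul]; exact h1.sub h2), weightedAvg_sub h1 h2,
    weightedAvg_const_mul, weightedAvg_const _ h0, ← hm]
  ring

end WeightedAvg

section Energy

variable {n : ℕ}

/-- The noise-free part of `∂_R H_{t,R}`. -/
noncomputable def signalEnergy (ω : (Fin n → ℝ) × Obs n) (x : Fin n → ℝ) : ℝ :=
  ∑ i, (x i ^ 2 / 2 - x i * ω.1 i)

/-- The coupling of `x` to the noise of the scalar channel. -/
noncomputable def noiseEnergy (ω : (Fin n → ℝ) × Obs n) (x : Fin n → ℝ) : ℝ :=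
  ∑ i, x i * ω.2.2 i

/-- The derivative `∂_R H_{t,R}`, which is `n L`. -/
noncomputable def energy (R : ℝ) (ω : (Fin n → ℝ) × Obs n) (x : Fin n → ℝ) : ℝ :=
  signalEnergy ω x - noiseEnergy ω x / (2 * √R)

/-- The Gibbs average at parameters `c` (spike channel) and `R` (scalar channel). -/
noncomputable def gibbsAvg (P0 : Measure ℝ) (c R : ℝ) (ω : (Fin n → ℝ) × Obs n)
    (a : (Fin n → ℝ) → ℝ) : ℝ :=
  weightedAvg (priorPi P0 n) (likelihood c (√R) (observe c (√R) ω)) a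

/-- The Gibbs variance of the energy. -/
noncomputable def thermalVar (P0 : Measure ℝ) (c R : ℝ) (ω : (Fin n → ℝ) × Obs n) : ℝ :=
  gibbsAvg P0 c R ω (fun x => energy R ω x ^ 2) - gibbsAvg P0 c R ω (energy R ω) ^ 2

theorem Lws_eq_energy (R : ℝ) (ω : (Fin n → ℝ) × Obs n) (x : Fin n → ℝ) :
    Lws n R ω.1 ω.2.2 x = 1 / n * energy R ω x := by
  rw [Lws, energy, signalEnergy, noiseEnergy, Finset.sum_div, ← Finset.sum_sub_distrib]

theorem continuous_uncurry_signalEnergy :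
    Continuous fun p : ((Fin n → ℝ) × Obs n) × (Fin n → ℝ) => signalEnergy p.1 p.2 := by
  unfold signalEnergy; fun_prop

theorem continuous_uncurry_noiseEnergy :
    Continuous fun p : ((Fin n → ℝ) × Obs n) × (Fin n → ℝ) => noiseEnergy p.1 p.2 := by
  unfold noiseEnergy; fun_prop

theorem continuous_uncurry_energy (R : ℝ) :
    Continuous fun p : ((Fin n → ℝ) × Obs n) × (Fin n → ℝ) => energy R p.1 p.2 :=
  continuous_uncurry_signalEnergy.sub (continuous_uncurry_noiseEnergy.div_const _)

theorem measurable_uncurry_energy (R : ℝ) :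
    Measurable (Function.uncurry (energy (n := n) R)) :=
  (continuous_uncurry_energy R).measurable

theorem measurable_uncurry_noiseEnergy :
    Measurable (Function.uncurry (noiseEnergy (n := n))) :=
  continuous_uncurry_noiseEnergy.measurable

theorem continuous_signalEnergy (ω : (Fin n → ℝ) × Obs n) : Continuous (signalEnergy ω) :=
  continuous_uncurry_signalEnergy.comp (by fun_prop : Continuous fun x => (ω, x))

theorem continuous_noiseEnergy (ω : (Fin n → ℝ) × Obs n) : Continuous (noiseEnergy ω) :=
  continuous_uncurry_noiseEnergy.comp (by fun_prop : Continuous fun x => (ω, x))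

theorem continuous_energy (R : ℝ) (ω : (Fin n → ℝ) × Obs n) : Continuous (energy R ω) :=
  (continuous_signalEnergy ω).sub ((continuous_noiseEnergy ω).div_const _)

/-- The `ℓ¹` norm of the scalar-channel noise. -/
noncomputable def noiseNorm (ω : (Fin n → ℝ) × Obs n) : ℝ := ∑ i, |ω.2.2 i|

/-- A bound of the energy for signals bounded by `S` and `R ≥ q ^ 2`. -/
noncomputable def energyBound (S q : ℝ) (ω : (Fin n → ℝ) × Obs n) : ℝ :=
  n * (2 * S ^ 2) + S * noiseNorm ω / (2 * q)

theorem noiseNorm_nonneg (ω : (Fin n → ℝ) × Obs n) : 0 ≤ noiseNorm ω :=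
  Finset.sum_nonneg fun _ _ => abs_nonneg _

variable {S q R : ℝ} {ω : (Fin n → ℝ) × Obs n} {x : Fin n → ℝ}

theorem energyBound_nonneg (hS : 0 ≤ S) (hq : 0 < q) : 0 ≤ energyBound S q ω := by
  have := noiseNorm_nonneg ω
  unfold energyBound
  positivity

theorem abs_noiseEnergy_le (hx : ∀ i, |x i| ≤ S) : |noiseEnergy ω x| ≤ S * noiseNorm ω := by
  rw [noiseEnergy, noiseNorm, Finset.mul_sum]
  refine (Finset.abs_sum_le_sum_abs _ _).trans (Finset.sum_le_sum fun i _ => ?_)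
  rw [abs_mul]
  exact mul_le_mul_of_nonneg_right (hx i) (abs_nonneg _)

theorem abs_energy_le (hS : 0 ≤ S) (hq : 0 < q) (hqR : q ≤ √R) (hω : ∀ i, |ω.1 i| ≤ S)
    (hx : ∀ i, |x i| ≤ S) : |energy R ω x| ≤ energyBound S q ω := by
  have h1 : |signalEnergy ω x| ≤ n * (2 * S ^ 2) := by
    have h : ∀ i ∈ (Finset.univ : Finset (Fin n)),
        |x i ^ 2 / 2 - x i * ω.1 i| ≤ 2 * S ^ 2 := by
      intro i _
      have h2 : |x i| ^ 2 ≤ S ^ 2 := pow_le_pow_left₀ (abs_nonneg _) (hx i) 2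
      have h3 : |x i| * |ω.1 i| ≤ S * S := mul_le_mul (hx i) (hω i) (abs_nonneg _) hS
      refine (abs_sub _ _).trans ?_
      rw [abs_mul, abs_div, abs_pow, abs_two]
      nlinarith [sq_nonneg S]
    refine (Finset.abs_sum_le_sum_abs _ _).trans ((Finset.sum_le_card_nsmul _ _ _ h).trans ?_)
    simp
  have h2 : |noiseEnergy ω x / (2 * √R)| ≤ S * noiseNorm ω / (2 * q) := by
    rw [abs_div, abs_of_pos (by linarith : 0 < 2 * √R)]
    exact div_le_div₀ (mul_nonneg hS (noiseNorm_nonneg ω)) (abs_noiseEnergy_le hx)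
      (by linarith) (by linarith)
  exact (abs_sub _ _).trans (add_le_add h1 h2)

end Energy

section Thermal

open Topology

variable {P0 : Measure ℝ} [IsProbabilityMeasure P0] {S : ℝ} {n : ℕ} {c R q : ℝ}
  {ω : (Fin n → ℝ) × Obs n}

theorem integrable_mul_likelihood (hsupp : ∀ᵐ x ∂P0, |x| ≤ S) {a : (Fin n → ℝ) → ℝ}
    (ha : Continuous a) (y : Obs n) (r : ℝ) :
    Integrable (fun x => a x * likelihood c r y x) (priorPi P0 n) :=
  integrable_priorPi_of_continuous hsupp (ha.mul (continuous_likelihood y))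

theorem integral_likelihood_pos (hsupp : ∀ᵐ x ∂P0, |x| ≤ S) (y : Obs n) (r : ℝ) :
    0 < ∫ x, likelihood c r y x ∂(priorPi P0 n) := by
  have hI := integrable_priorPi_of_continuous (P0 := P0) hsupp
    (continuous_likelihood (c := c) (r := r) y)
  rw [integral_pos_iff_support_of_nonneg (fun x => (likelihood_pos y x).le) hI,
    Function.support_eq_univ fun x => (likelihood_pos y x).ne', measure_univ]
  exact one_pos

theorem measurable_gibbsAvg {a : (Fin n → ℝ) × Obs n → (Fin n → ℝ) → ℝ}
    (ha : Measurable (Function.uncurry a)) : Measurable fun ω => gibbsAvg P0 c R ω (a ω) := by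
  have h1 : Measurable fun p : ((Fin n → ℝ) × Obs n) × (Fin n → ℝ) => (observe c (√R) p.1, p.2) :=
    (continuous_observe.measurable.comp measurable_fst).prodMk measurable_snd
  have h2 : Measurable (Function.uncurry (likelihood (n := n) c (√R))) :=
    continuous_uncurry_likelihood.measurable
  have h3 : Measurable (Function.uncurry fun (ω : (Fin n → ℝ) × Obs n) =>
      likelihood c (√R) (observe c (√R) ω)) := by
    have := h2.comp h1
    simp only [Function.comp_def, Function.uncurry_apply_pair] at this
    exact this
  exact measurable_weightedAvg h3 ha

theorem measurable_thermalVar : Measurable fun ω : (Fin n → ℝ) × Obs n => thermalVar P0 c R ω :=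
  (measurable_gibbsAvg ((measurable_uncurry_energy R).pow_const 2)).sub
    ((measurable_gibbsAvg (measurable_uncurry_energy R)).pow_const 2)

theorem likelihood_observe_eq (hR : 0 < R) : likelihood c (√R) (observe c (√R) ω) = fun x =>
    Real.exp (∑ p, (spike c x p * (ω.2.1 p + spike c ω.1 p) - spike c x p ^ 2 / 2)
      - R * signalEnergy ω x + √R * noiseEnergy ω x) := by
  ext x
  rw [likelihood, ← Real.exp_add]
  congr 1
  rw [sub_add, sub_eq_add_neg]
  congr 1
  rw [signalEnergy, noiseEnergy, Finset.mul_sum, Finset.mul_sum, ← Finset.sum_sub_distrib,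
    ← Finset.sum_neg_distrib]
  refine Finset.sum_congr rfl fun i _ => ?_
  simp only [observe, Prod.snd_add, Pi.add_apply, Pi.smul_apply, smul_eq_mul]
  linear_combination (x i * ω.1 i - x i ^ 2 / 2) * Real.sq_sqrt hR.le

theorem hasDerivAt_gibbsAvg_energy (hsupp : ∀ᵐ x ∂P0, |x| ≤ S) (hR : 0 < R) :
    HasDerivAt (fun R => gibbsAvg P0 c R ω (energy R ω))
      (gibbsAvg P0 c R ω (noiseEnergy ω) / (4 * R * √R) - thermalVar P0 c R ω) R := by
  refine hasDerivAt_weightedAvg_energy (P := priorPi P0 n)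
    (w := fun R => likelihood c (√R) (observe c (√R) ω))
    (a := fun x => ∑ p, (spike c x p * (ω.2.1 p + spike c ω.1 p) - spike c x p ^ 2 / 2))
    (isCompact_univ_pi fun _ : Fin n => isCompact_Icc (a := -S) (b := S)) ?_ (by fun_prop)
    (continuous_signalEnergy ω) (continuous_noiseEnergy ω)
    (fun R hR => likelihood_observe_eq hR) hR
  filter_upwards [ae_priorPi_abs_le hsupp] with x hx i _
  exact abs_le.1 (hx i)

theorem abs_gibbsAvg_energy_le (hS : 0 ≤ S) (hsupp : ∀ᵐ x ∂P0, |x| ≤ S) (hq : 0 < q)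
    (hqR : q ≤ √R) (hω : ∀ i, |ω.1 i| ≤ S) :
    |gibbsAvg P0 c R ω (energy R ω)| ≤ energyBound S q ω :=
  abs_weightedAvg_likelihood_le hsupp (energyBound_nonneg hS hq)
    ((ae_priorPi_abs_le hsupp).mono fun _ hx => abs_energy_le hS hq hqR hω hx) _

theorem abs_thermalVar_le (hS : 0 ≤ S) (hsupp : ∀ᵐ x ∂P0, |x| ≤ S) (hq : 0 < q)
    (hqR : q ≤ √R) (hω : ∀ i, |ω.1 i| ≤ S) :
    |thermalVar P0 c R ω| ≤ 2 * energyBound S q ω ^ 2 := by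
  have h1 : |gibbsAvg P0 c R ω (fun x => energy R ω x ^ 2)| ≤ energyBound S q ω ^ 2 :=
    abs_weightedAvg_likelihood_le hsupp (sq_nonneg _) ((ae_priorPi_abs_le hsupp).mono fun x hx => by
      rw [abs_pow]
      exact pow_le_pow_left₀ (abs_nonneg _) (abs_energy_le hS hq hqR hω hx) 2) _
  have h2 := pow_le_pow_left₀ (abs_nonneg _)
    (abs_gibbsAvg_energy_le (c := c) hS hsupp hq hqR hω) 2
  refine (abs_sub _ _).trans ?_
  rw [abs_pow (gibbsAvg P0 c R ω (energy R ω))]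
  linarith

theorem abs_gibbsAvg_noiseEnergy_le (hS : 0 ≤ S) (hsupp : ∀ᵐ x ∂P0, |x| ≤ S) :
    |gibbsAvg P0 c R ω (noiseEnergy ω)| ≤ S * noiseNorm ω :=
  abs_weightedAvg_likelihood_le hsupp (mul_nonneg hS (noiseNorm_nonneg ω))
    ((ae_priorPi_abs_le hsupp).mono fun _ hx => abs_noiseEnergy_le hx) _

theorem memLp_noiseNorm :
    MemLp (fun ω : (Fin n → ℝ) × Obs n => noiseNorm ω) 2 (quenched P0 n) :=
  memLp_finsetSum Finset.univ fun _ _ => memLp_noise.abs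

theorem memLp_energyBound :
    MemLp (fun ω : (Fin n → ℝ) × Obs n => energyBound S q ω) 2 (quenched P0 n) := by
  have h : MemLp (fun ω : (Fin n → ℝ) × Obs n => S / (2 * q) * noiseNorm ω) 2 (quenched P0 n) :=
    memLp_noiseNorm.const_mul _
  have h0 : MemLp (fun _ : (Fin n → ℝ) × Obs n => n * (2 * S ^ 2)) 2 (quenched P0 n) :=
    memLp_const _
  have e : (fun ω : (Fin n → ℝ) × Obs n => energyBound S q ω)
      = (fun _ => n * (2 * S ^ 2)) + fun ω => S / (2 * q) * noiseNorm ω := by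
    funext ω
    rw [Pi.add_apply, energyBound, mul_div_right_comm]
  rw [e]
  exact h0.add h

theorem integrable_thermalVar (hS : 0 ≤ S) (hsupp : ∀ᵐ x ∂P0, |x| ≤ S) (hR : 0 < R) :
    Integrable (fun ω => thermalVar P0 c R ω) (quenched P0 n) := by
  have h : Integrable (fun ω : (Fin n → ℝ) × Obs n => 2 * energyBound S √R ω ^ 2)
      (quenched P0 n) := memLp_energyBound.integrable_sq.const_mul 2
  refine h.mono' measurable_thermalVar.aestronglyMeasurable ?_
  filter_upwards [ae_quenched_signal_le hsupp] with ω hω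
  exact abs_thermalVar_le hS hsupp (Real.sqrt_pos.2 hR) le_rfl hω

theorem integrable_gibbsAvg_noiseEnergy (hS : 0 ≤ S) (hsupp : ∀ᵐ x ∂P0, |x| ≤ S) :
    Integrable (fun ω => gibbsAvg P0 c R ω (noiseEnergy ω)) (quenched P0 n) :=
  ((memLp_noiseNorm.integrable one_le_two).const_mul S).mono'
    (measurable_gibbsAvg measurable_uncurry_noiseEnergy).aestronglyMeasurable
    (.of_forall fun _ => abs_gibbsAvg_noiseEnergy_le hS hsupp)

theorem hasDerivAt_integral_gibbsAvg_energy (hS : 0 ≤ S) (hsupp : ∀ᵐ x ∂P0, |x| ≤ S)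
    (hR : 0 < R) :
    HasDerivAt (fun R => ∫ ω, gibbsAvg P0 c R ω (energy R ω) ∂(quenched P0 n))
      (∫ ω, (gibbsAvg P0 c R ω (noiseEnergy ω) / (4 * R * √R) - thermalVar P0 c R ω)
        ∂(quenched P0 n)) R := by
  have hpos : ∀ r ∈ Metric.closedBall R (R / 2), R / 2 ≤ r := by
    intro r hr
    rw [Metric.mem_closedBall, Real.dist_eq, abs_le] at hr
    linarith [hr.1]
  have hq : 0 < √(R / 2) := Real.sqrt_pos.2 (half_pos hR)
  have hmeas (r : ℝ) : Measurable fun ω : (Fin n → ℝ) × Obs n => gibbsAvg P0 c r ω (energy r ω) :=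
    measurable_gibbsAvg (measurable_uncurry_energy r)
  refine (hasDerivAt_integral_of_dominated_loc_of_deriv_le
    (F' := fun R ω => gibbsAvg P0 c R ω (noiseEnergy ω) / (4 * R * √R) - thermalVar P0 c R ω)
    (bound := fun ω => S * noiseNorm ω / (4 * (R / 2) * √(R / 2))
      + 2 * energyBound S √(R / 2) ω ^ 2)
    (Metric.closedBall_mem_nhds R (half_pos hR)) ?_ ?_ ?_ ?_ ?_ ?_).2
  · exact .of_forall fun r => (hmeas r).aestronglyMeasurable
  · refine ((memLp_energyBound (S := S) (q := √R)).integrable one_le_two).mono'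
      (hmeas R).aestronglyMeasurable ?_
    filter_upwards [ae_quenched_signal_le hsupp] with ω hω
    exact abs_gibbsAvg_energy_le hS hsupp (Real.sqrt_pos.2 hR) le_rfl hω
  · exact (((integrable_gibbsAvg_noiseEnergy hS hsupp).div_const _).sub
      (integrable_thermalVar hS hsupp hR)).aestronglyMeasurable
  · filter_upwards [ae_quenched_signal_le hsupp] with ω hω r hr
    have hr2 := hpos r hr
    have hsq : √(R / 2) ≤ √r := Real.sqrt_le_sqrt hr2
    refine (abs_sub _ _).trans (add_le_add ?_ (abs_thermalVar_le hS hsupp hq hsq hω))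
    have hr0 : 0 < r := (half_pos hR).trans_le hr2
    rw [abs_div, abs_of_pos (a := 4 * r * √r) (mul_pos (by linarith) (hq.trans_le hsq))]
    exact div_le_div₀ (mul_nonneg hS (noiseNorm_nonneg ω)) (abs_gibbsAvg_noiseEnergy_le hS hsupp)
      (by positivity) (by gcongr)
  · exact (((memLp_noiseNorm.integrable one_le_two).const_mul S).div_const _).add
      (memLp_energyBound.integrable_sq.const_mul 2)
  · filter_upwards with ω r hr
    exact hasDerivAt_gibbsAvg_energy hsupp ((half_pos hR).trans_le (hpos r hr))

end Thermal

section OverlapDerivative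

variable {P0 : Measure ℝ} [IsProbabilityMeasure P0] {S : ℝ} {n : ℕ} {c R : ℝ}

theorem gibbsAvg_noiseEnergy (hsupp : ∀ᵐ x ∂P0, |x| ≤ S) (ω : (Fin n → ℝ) × Obs n) :
    gibbsAvg P0 c R ω (noiseEnergy ω)
      = ∑ i, ω.2.2 i * postMean P0 c (√R) i (observe c (√R) ω) := by
  have h := weightedAvg_sum (s := Finset.univ) (a := fun i x => x i * ω.2.2 i)
    fun i _ => integrable_mul_likelihood hsupp (by fun_prop) (observe c (√R) ω) (√R) (c := c)
  refine h.trans (Finset.sum_congr rfl fun i _ => ?_)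
  rw [weightedAvg_mul_const, mul_comm]
  rfl

theorem gibbsAvg_energy (hsupp : ∀ᵐ x ∂P0, |x| ≤ S) (ω : (Fin n → ℝ) × Obs n) :
    gibbsAvg P0 c R ω (energy R ω)
      = ∑ i, (gibbsAvg P0 c R ω (fun x => x i ^ 2) / 2
        - ω.1 i * postMean P0 c (√R) i (observe c (√R) ω)
        - ω.2.2 i * postMean P0 c (√R) i (observe c (√R) ω) / (2 * √R)) := by
  have e : energy R ω
      = fun x => ∑ i, (1 / 2 * x i ^ 2 - x i * (ω.1 i + ω.2.2 i / (2 * √R))) := by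
    ext x
    rw [energy, signalEnergy, noiseEnergy, Finset.sum_div, ← Finset.sum_sub_distrib]
    exact Finset.sum_congr rfl fun i _ => by ring
  have hint {a : (Fin n → ℝ) → ℝ} (ha : Continuous a) :=
    integrable_mul_likelihood (c := c) hsupp ha (observe c (√R) ω) (√R)
  rw [e, gibbsAvg, weightedAvg_sum fun i _ => hint (by fun_prop)]
  refine Finset.sum_congr rfl fun i _ => ?_
  rw [weightedAvg_sub (hint (by fun_prop)) (hint (by fun_prop)), weightedAvg_const_mul,
    weightedAvg_mul_const]
  simp only [gibbsAvg, postMean]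
  ring

theorem integrable_noise_mul_postMean (hS : 0 ≤ S) (hsupp : ∀ᵐ x ∂P0, |x| ≤ S) {r : ℝ}
    (i : Fin n) :
    Integrable (fun ω => ω.2.2 i * postMean P0 c r i (observe c r ω)) (quenched P0 n) :=
  integrable_mul_of_memLp memLp_noise (memLp_postMean_observe hS hsupp)

theorem integral_gibbsAvg_noiseEnergy (hS : 0 ≤ S) (hsupp : ∀ᵐ x ∂P0, |x| ≤ S) :
    ∫ ω, gibbsAvg P0 c R ω (noiseEnergy ω) ∂(quenched P0 n)
      = √R * ∑ i : Fin n, (∫ x, x ^ 2 ∂P0 - overlap P0 c (√R) i) := by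
  simp only [gibbsAvg_noiseEnergy hsupp]
  rw [integral_finsetSum _ fun i _ => integrable_noise_mul_postMean hS hsupp i, Finset.mul_sum]
  exact Finset.sum_congr rfl fun i _ => integral_noise_mul_postMean hS hsupp

theorem integral_gibbsAvg_energy (hS : 0 ≤ S) (hsupp : ∀ᵐ x ∂P0, |x| ≤ S) (hR : 0 < R) :
    ∫ ω, gibbsAvg P0 c R ω (energy R ω) ∂(quenched P0 n)
      = -(∑ i : Fin n, overlap P0 c (√R) i) / 2 := by
  have h1 (i : Fin n) : Integrable (fun ω => gibbsAvg P0 c R ω (fun x => x i ^ 2) / 2)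
      (quenched P0 n) := by
    refine Integrable.div_const (Integrable.of_bound (C := S ^ 2)
      (measurable_gibbsAvg (a := fun _ x => x i ^ 2) (by fun_prop)).aestronglyMeasurable
      (.of_forall fun ω => ?_)) 2
    refine abs_weightedAvg_likelihood_le hsupp (sq_nonneg S)
      ((ae_priorPi_abs_le hsupp).mono fun x hx => ?_) _
    rw [abs_pow]
    exact pow_le_pow_left₀ (abs_nonneg _) (hx i) 2
  have h2 (i : Fin n) : Integrable
      (fun ω => ω.1 i * postMean P0 c (√R) i (observe c (√R) ω)) (quenched P0 n) :=
    integrable_mul_of_memLp (memLp_signal hsupp) (memLp_postMean_observe hS hsupp)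
  have h3 (i : Fin n) : Integrable
      (fun ω => ω.2.2 i * postMean P0 c (√R) i (observe c (√R) ω) / (2 * √R)) (quenched P0 n) :=
    (integrable_noise_mul_postMean hS hsupp i).div_const _
  have h4 (i : Fin n) : Integrable (fun ω => gibbsAvg P0 c R ω (fun x => x i ^ 2) / 2
      - ω.1 i * postMean P0 c (√R) i (observe c (√R) ω)) (quenched P0 n) := (h1 i).sub (h2 i)
  have h5 (i : Fin n) : Integrable (fun ω => gibbsAvg P0 c R ω (fun x => x i ^ 2) / 2
      - ω.1 i * postMean P0 c (√R) i (observe c (√R) ω)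
      - ω.2.2 i * postMean P0 c (√R) i (observe c (√R) ω) / (2 * √R)) (quenched P0 n) :=
    (h4 i).sub (h3 i)
  simp only [gibbsAvg_energy hsupp]
  rw [integral_finsetSum _ fun i _ => h5 i, ← Finset.sum_neg_distrib,
    Finset.sum_div]
  refine Finset.sum_congr rfl fun i _ => ?_
  have hsq : ∫ ω, gibbsAvg P0 c R ω (fun x => x i ^ 2) ∂(quenched P0 n) = ∫ x, x ^ 2 ∂P0 :=
    integral_weightedAvg_sq hsupp
  rw [integral_sub (h4 i) (h3 i), integral_sub (h1 i) (h2 i), integral_div,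
    integral_div, hsq, integral_signal_mul_postMean hS hsupp, integral_noise_mul_postMean hS hsupp]
  have h0 : √R ≠ 0 := (Real.sqrt_pos.2 hR).ne'
  field_simp
  ring

theorem hasDerivAt_sum_overlap (hS : 0 ≤ S) (hsupp : ∀ᵐ x ∂P0, |x| ≤ S) (hR : 0 < R) :
    HasDerivAt (fun R => (∑ i : Fin n, overlap P0 c (√R) i) / 2)
      (∫ ω, thermalVar P0 c R ω ∂(quenched P0 n)
        - (∑ i : Fin n, (∫ x, x ^ 2 ∂P0 - overlap P0 c (√R) i)) / (4 * R)) R := by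
  have h := (hasDerivAt_integral_gibbsAvg_energy (n := n) (c := c) hS hsupp hR).neg
  rw [integral_sub ((integrable_gibbsAvg_noiseEnergy hS hsupp).div_const _)
    (integrable_thermalVar hS hsupp hR), integral_div, integral_gibbsAvg_noiseEnergy hS hsupp] at h
  refine (h.congr_of_eventuallyEq ?_).congr_deriv ?_
  · filter_upwards [lt_mem_nhds hR] with r hr
    rw [Pi.neg_apply, integral_gibbsAvg_energy hS hsupp hr, neg_div, neg_neg]
  · have h0 : √R ≠ 0 := (Real.sqrt_pos.2 hR).ne'
    field_simp
    ring

theorem sum_overlap_le (hS : 0 ≤ S) (hsupp : ∀ᵐ x ∂P0, |x| ≤ S) (r : ℝ) :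
    ∑ i : Fin n, overlap P0 c r i ≤ n * ∫ x, x ^ 2 ∂P0 := by
  simpa using Finset.sum_le_sum fun (i : Fin n) (_ : i ∈ Finset.univ) =>
    overlap_le (c := c) (r := r) (i := i) hS hsupp

theorem derivative_sum_overlap_nonneg (hS : 0 ≤ S) (hsupp : ∀ᵐ x ∂P0, |x| ≤ S) (hR : 0 < R)
    {d : ℝ} (hd : HasDerivAt (fun R => (∑ i : Fin n, overlap P0 c (√R) i) / 2) d R) : 0 ≤ d := by
  have hmono : MonotoneOn (fun R => (∑ i : Fin n, overlap P0 c (√R) i) / 2) (Set.Ioi 0) := by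
    intro r hr r' _ hrr
    refine div_le_div_of_nonneg_right (Finset.sum_le_sum fun i _ => ?_) zero_le_two
    exact overlap_mono hS hsupp (Real.sqrt_pos.2 hr) (Real.sqrt_le_sqrt hrr)
  have h := hmono.derivWithin_nonneg (x := R)
  rwa [hd.hasDerivWithinAt.derivWithin (isOpen_Ioi.uniqueDiffWithinAt hR)] at h

theorem integral_thermalVar_le (hS : 0 ≤ S) (hsupp : ∀ᵐ x ∂P0, |x| ≤ S) (hR : 0 < R) :
    ∃ d, 0 ≤ d ∧ HasDerivAt (fun R => (∑ i : Fin n, overlap P0 c (√R) i) / 2) d R ∧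
      ∫ ω, thermalVar P0 c R ω ∂(quenched P0 n) ≤ d + n * (∫ x, x ^ 2 ∂P0) / (4 * R) := by
  have hd := hasDerivAt_sum_overlap (n := n) (c := c) hS hsupp hR
  refine ⟨_, derivative_sum_overlap_nonneg hS hsupp hR hd, hd, ?_⟩
  have h1 : ∑ i : Fin n, (∫ x, x ^ 2 ∂P0 - overlap P0 c (√R) i) ≤ n * ∫ x, x ^ 2 ∂P0 := by
    have : 0 ≤ ∑ i : Fin n, overlap P0 c (√R) i := Finset.sum_nonneg fun i _ => overlap_nonneg
    rw [Finset.sum_sub_distrib]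
    simpa using this
  have h2 := div_le_div_of_nonneg_right h1 (by linarith : 0 ≤ 4 * R)
  linarith

/-- The quenched Gibbs variance of `L`. -/
theorem EWS_variance_Lws (hS : 0 ≤ S) (hsupp : ∀ᵐ x ∂P0, |x| ≤ S) {t : ℝ} (ht : t ≤ 1)
    (hn : n ≠ 0) (hR : 0 < R) :
    EWS P0 n (fun X Z Zt => gibbsWS P0 n t R X Z Zt
        (fun x => (Lws n R X Zt x
          - gibbsWS P0 n t R X Z Zt (fun x' => Lws n R X Zt x')) ^ 2))
      = (∫ ω, thermalVar P0 (√((1 - t) / n)) R ω ∂(quenched P0 n)) / n ^ 2 := by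
  set c := √((1 - t) / n) with hc
  have key (ω : (Fin n → ℝ) × Obs n) : gibbsWS P0 n t R ω.1 ω.2.1 ω.2.2
      (fun x => (Lws n R ω.1 ω.2.2 x
        - gibbsWS P0 n t R ω.1 ω.2.1 ω.2.2 (fun x' => Lws n R ω.1 ω.2.2 x')) ^ 2)
      = (1 / n : ℝ) ^ 2 * thermalVar P0 c R ω := by
    have hE := continuous_energy R ω
    simp only [gibbsWS_eq_weightedAvg P0 ht hn hR, Lws_eq_energy, weightedAvg_const_mul,
      ← mul_sub, mul_pow]
    rw [thermalVar, gibbsAvg, gibbsAvg, ← weightedAvg_variance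
      (integral_likelihood_pos hsupp _ _).ne'
      (integrable_priorPi_of_continuous hsupp (continuous_likelihood _))
      (integrable_mul_likelihood hsupp hE _ _) (integrable_mul_likelihood hsupp (hE.pow 2) _ _)]
  have hI : Integrable (fun ω => (1 / n : ℝ) ^ 2 * thermalVar P0 c R ω) (quenched P0 n) :=
    (integrable_thermalVar hS hsupp hR).const_mul _
  rw [EWS, div_eq_inv_mul, ← inv_pow, ← one_div, ← integral_const_mul, integral_prod _ hI]
  refine integral_congr_ae ?_
  filter_upwards [hI.prod_right_ae] with X hX
  rw [integral_prod _ hX]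
  exact integral_congr_ae (.of_forall fun Z => integral_congr_ae (.of_forall fun Zt =>
    key (X, Z, Zt)))

end OverlapDerivative

/-- Thermal concentration of `L` for the interpolating Wigner spike model: if
`ε ↦ R_ε(t)` is regular (C¹ diffeomorphism with Jacobian ≥ 1) and `R_ε(t) ≥ ε`, then
`∫_{s_n}^{2s_n} dε E⟨(L - ⟨L⟩_{t,ε})²⟩_{t,ε} ≤ (ρ/n)(1 + (ln 2)/4)`. -/
theorem wignerSpike_L_thermal_concentration (S : ℝ) (hS : 0 < S)
    (P0 : Measure ℝ) [IsProbabilityMeasure P0]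
    (hsupp : ∀ᵐ x ∂P0, x ∈ Set.Icc (-S) S)
    (ρ : ℝ) (hρ : ρ = ∫ x, x ^ 2 ∂P0)
    (n : ℕ) (hn : 1 ≤ n) (t : ℝ) (ht : t ∈ Set.Icc (0 : ℝ) 1)
    (sn : ℝ) (hsn : sn ∈ Set.Ioc (0 : ℝ) (1 / 2))
    (R R' : ℝ → ℝ)
    (hRge : ∀ ε ∈ Set.Icc sn (2 * sn), ε ≤ R ε)
    (hderiv : ∀ ε, HasDerivAt R (R' ε) ε)
    (hcont : Continuous R')
    (hjac : ∀ ε ∈ Set.Icc sn (2 * sn), 1 ≤ R' ε) :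
    ∫ ε in sn..(2 * sn),
        EWS P0 n (fun X Z Zt => gibbsWS P0 n t (R ε) X Z Zt
          (fun x => (Lws n (R ε) X Zt x
            - gibbsWS P0 n t (R ε) X Z Zt (fun x' => Lws n (R ε) X Zt x')) ^ 2))
      ≤ (ρ / n) * (1 + Real.log 2 / 4) := by
  have hs : 0 < sn := hsn.1
  have hsupp' : ∀ᵐ x ∂P0, |x| ≤ S := hsupp.mono fun x hx => abs_le.2 hx
  have hn0 : (0 : ℝ) < n := by exact_mod_cast hn
  have hab : sn ≤ 2 * sn := by linarith
  have hρ0 : 0 ≤ ρ := hρ ▸ integral_nonneg fun x => sq_nonneg x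
  have hlog : 0 ≤ Real.log 2 := Real.log_nonneg one_le_two
  by_cases hint : IntervalIntegrable (fun ε =>
      EWS P0 n (fun X Z Zt => gibbsWS P0 n t (R ε) X Z Zt
        (fun x => (Lws n (R ε) X Zt x
          - gibbsWS P0 n t (R ε) X Z Zt (fun x' => Lws n (R ε) X Zt x')) ^ 2))) volume sn (2 * sn)
  swap
  · rw [intervalIntegral.integral_undef hint]
    positivity
  set c := √((1 - t) / n) with hc
  have hRpos : ∀ ε ∈ Set.Icc sn (2 * sn), 0 < R ε := fun ε hε =>
    hs.trans_le (hε.1.trans (hRge ε hε))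
  have hd (r : ℝ) (hr : 0 < r) := integral_thermalVar_le (n := n) (c := c) hS.le hsupp' hr
  choose! d hd0 hd hvar using hd
  have hg (ε : ℝ) (hε : ε ∈ Set.Icc sn (2 * sn)) :
      HasDerivAt (fun ε => (n * ρ / 4 * Real.log ε
          + (∑ i : Fin n, overlap P0 c (√(R ε)) i) / 2) / n ^ 2)
        ((n * ρ / 4 * ε⁻¹ + d (R ε) * R' ε) / n ^ 2) ε :=
    (((Real.hasDerivAt_log (hs.trans_le hε.1).ne').const_mul _).add
      ((hd _ (hRpos ε hε)).comp ε (hderiv ε))).div_const _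
  refine (intervalIntegral.integral_le_sub_of_hasDeriv_right_of_le hab
    (fun ε hε => (hg ε hε).continuousAt.continuousWithinAt)
    (fun ε hε => (hg ε (Set.Ioo_subset_Icc_self hε)).hasDerivWithinAt)
    ((intervalIntegrable_iff_integrableOn_Icc_of_le hab).1 hint) fun ε hε => ?_).trans ?_
  · have hε' := Set.Ioo_subset_Icc_self hε
    have hR := hRpos ε hε'
    have hε0 : 0 < ε := hs.trans hε.1
    rw [EWS_variance_Lws hS.le hsupp' ht.2 (by omega) hR]
    refine div_le_div_of_nonneg_right ((hvar _ hR).trans ?_) (sq_nonneg _)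
    have h1 : d (R ε) ≤ d (R ε) * R' ε := le_mul_of_one_le_right (hd0 _ hR) (hjac ε hε')
    have h2 : n * (∫ x, x ^ 2 ∂P0) / (4 * R ε) ≤ n * ρ / 4 * ε⁻¹ := by
      rw [← hρ, ← div_eq_mul_inv, div_div]
      exact div_le_div_of_nonneg_left (by positivity) (by linarith) (by linarith [hRge ε hε'])
    linarith
  · have h1 : (∑ i : Fin n, overlap P0 c (√(R (2 * sn))) i) / 2 ≤ n * ρ := by
      have := sum_overlap_le (n := n) (c := c) hS.le hsupp' √(R (2 * sn))
      rw [← hρ] at this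
      linarith [mul_nonneg hn0.le hρ0]
    have h2 : 0 ≤ (∑ i : Fin n, overlap P0 c (√(R sn)) i) / 2 :=
      div_nonneg (Finset.sum_nonneg fun i _ => overlap_nonneg) zero_le_two
    rw [← sub_div, div_le_iff₀ (by positivity), Real.log_mul two_ne_zero hs.ne']
    have h3 : ρ / n * (1 + Real.log 2 / 4) * n ^ 2 = n * ρ * (1 + Real.log 2 / 4) := by
      field_simp
    rw [h3]
    linarith
end

section
/- In the interpolating Wigner spike model (prior P_0 supported on [-S,S], time t∈[0,1], SNR R_ε(t)>0), let Q = (1/n)Σ_{i=1}^n x_iX_i be the overlap and L = (1/n)Σ_{i=1}^n( x_i²/2 - x_iX_i - x_iZ̃_i/(2√R_ε(t)) ). Then the Wigner-spike Gibbs/quenched averages satisfy E⟨(Q - E⟨Q⟩_{t,ε})²⟩_{t,ε} ≤ 4 E⟨(L - E⟨L⟩_{t,ε})²⟩_{t,ε}. -/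
open Finset MeasureTheory ProbabilityTheory

/-! ### The standard Gaussian measure -/

lemma stdGauss_eq_withDensity :
    stdGauss = volume.withDensity (fun z => ENNReal.ofReal (gaussianPDFReal 0 1 z)) :=
  gaussianReal_of_var_ne_zero 0 one_ne_zero

lemma stdGauss_map_const_add (a : ℝ) :
    stdGauss.map (fun z => a + z)
      = stdGauss.withDensity (fun z => ENNReal.ofReal (Real.exp (a * z - a ^ 2 / 2))) := by
  rw [stdGauss, gaussianReal_map_const_add, gaussianReal_of_var_ne_zero _ one_ne_zero,
    gaussianReal_of_var_ne_zero _ one_ne_zero,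
    ← withDensity_mul _ (measurable_gaussianPDF _ _) (by fun_prop)]
  congr 1
  ext z
  simp only [gaussianPDF, Pi.mul_apply]
  rw [← ENNReal.ofReal_mul (gaussianPDFReal_nonneg _ _ _)]
  congr 1
  simp only [gaussianPDFReal, mul_assoc, ← Real.exp_add]
  congr 3
  simp
  ring

lemma integrable_exp_stdGauss (a : ℝ) :
    Integrable (fun z => Real.exp (a * z - a ^ 2 / 2)) stdGauss := by
  refine ⟨by fun_prop, ?_⟩
  rw [hasFiniteIntegral_iff_ofReal (ae_of_all _ fun _ => (Real.exp_pos _).le),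
    ← setLIntegral_univ, ← withDensity_apply _ MeasurableSet.univ, ← stdGauss_map_const_add]
  exact measure_lt_top _ _

section Pi

variable {ι : Type*} [Fintype ι]

/-- The standard Gaussian measure on `ℝ^ι`. -/
noncomputable def stdGaussPi (ι : Type*) [Fintype ι] : Measure (ι → ℝ) :=
  Measure.pi fun _ => stdGauss

instance : IsProbabilityMeasure (stdGaussPi ι) :=
  inferInstanceAs (IsProbabilityMeasure (Measure.pi fun _ : ι => stdGauss))

lemma stdGaussPi_map_const_add (a : ι → ℝ) :
    (stdGaussPi ι).map (fun z => a + z) = (stdGaussPi ι).withDensity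
      (fun z => ENNReal.ofReal (Real.exp (∑ i, (a i * z i - a i ^ 2 / 2)))) := by
  have h (i : ι) : IsProbabilityMeasure (stdGauss.map fun z => a i + z) :=
    Measure.isProbabilityMeasure_map (by fun_prop)
  have h1 := Measure.pi_map_pi (μ := fun _ : ι => stdGauss) (f := fun i z => a i + z)
    (fun i => by fun_prop)
  refine h1.trans (Measure.pi_eq fun s hs => ?_)
  have key (t : Set ℝ) (ht : MeasurableSet t) (i : ι) : stdGauss.map (fun z => a i + z) t
      = ENNReal.ofReal (∫ z, t.indicator (fun z => Real.exp (a i * z - a i ^ 2 / 2)) z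
          ∂stdGauss) := by
    rw [stdGauss_map_const_add, withDensity_apply _ ht, integral_indicator ht,
      ofReal_integral_eq_lintegral_ofReal (integrable_exp_stdGauss _).integrableOn
        (ae_of_all _ fun _ => (Real.exp_pos _).le)]
  have hnn (i : ι) (z : ℝ) :
      0 ≤ (s i).indicator (fun z => Real.exp (a i * z - a i ^ 2 / 2)) z :=
    Set.indicator_nonneg (fun _ _ => (Real.exp_pos _).le) _
  rw [withDensity_apply _ (MeasurableSet.univ_pi hs), ← lintegral_indicator
    (MeasurableSet.univ_pi hs), Finset.prod_congr rfl fun i _ => key (s i) (hs i) i,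
    ← ENNReal.ofReal_prod_of_nonneg fun i _ => integral_nonneg (hnn i),
    ← integral_fintype_prod_eq_prod, ofReal_integral_eq_lintegral_ofReal
      (Integrable.fintype_prod fun i => (integrable_exp_stdGauss _).indicator (hs i))
      (ae_of_all _ fun z => Finset.prod_nonneg fun i _ => hnn i _)]
  refine lintegral_congr fun z => ?_
  by_cases hz : z ∈ Set.univ.pi s
  · rw [Set.indicator_of_mem hz, Real.exp_sum]
    congr 1
    exact Finset.prod_congr rfl fun i _ => by rw [Set.indicator_of_mem (hz i trivial)]
  · rw [Set.indicator_of_notMem hz]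
    obtain ⟨i, hi⟩ : ∃ i, z i ∉ s i := by simpa using hz
    rw [Finset.prod_eq_zero (Finset.mem_univ i) (Set.indicator_of_notMem hi _),
      ENNReal.ofReal_zero]

/-- **Cameron–Martin formula** in finite dimension. -/
lemma integral_stdGaussPi_const_add (a : ι → ℝ) (F : (ι → ℝ) → ℝ) :
    ∫ z, F (a + z) ∂stdGaussPi ι
      = ∫ y, Real.exp (∑ i, (a i * y i - a i ^ 2 / 2)) * F y ∂stdGaussPi ι := by
  have h := integral_map_equiv (μ := stdGaussPi ι) (MeasurableEquiv.addLeft a) F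
  simp only [MeasurableEquiv.coe_addLeft] at h
  rw [← h]
  change ∫ y, F y ∂(stdGaussPi ι).map (fun z => a + z) = _
  rw [stdGaussPi_map_const_add, integral_withDensity_eq_integral_toReal_smul (by fun_prop)
    (ae_of_all _ fun _ => ENNReal.ofReal_lt_top)]
  refine integral_congr_ae (ae_of_all _ fun y => ?_)
  simp only [smul_eq_mul]
  rw [ENNReal.toReal_ofReal (Real.exp_pos _).le]

lemma memLp_eval_stdGaussPi (i : ι) : MemLp (fun z : ι → ℝ => z i) 2 (stdGaussPi ι) :=
  (memLp_id_gaussianReal (μ := 0) (v := 1) 2).comp_measurePreserving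
    (measurePreserving_eval (fun _ : ι => stdGauss) i)

open Classical in
/-- Resampling one coordinate leaves the product measure invariant. -/
lemma measurePreserving_update_stdGaussPi (i : ι) :
    MeasurePreserving (fun p : (ι → ℝ) × ℝ => Function.update p.1 i p.2)
      ((stdGaussPi ι).prod stdGauss) (stdGaussPi ι) := by
  have hm : Measurable (fun p : (ι → ℝ) × ℝ => Function.update p.1 i p.2) := by
    refine measurable_pi_lambda _ fun j => ?_
    by_cases h : j = i
    · subst h; simpa using measurable_snd
    · simp only [Function.update_of_ne h]; fun_prop
  refine ⟨hm, (Measure.pi_eq fun s hs => ?_).symm⟩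
  rw [Measure.map_apply hm (MeasurableSet.univ_pi hs)]
  have : (fun p : (ι → ℝ) × ℝ => Function.update p.1 i p.2) ⁻¹' Set.univ.pi s
      = (Set.univ.pi (Function.update s i Set.univ)) ×ˢ s i := by
    ext p
    simp only [Set.mem_preimage, Set.mem_pi, Set.mem_univ, true_imp_iff, Set.mem_prod]
    constructor
    · intro h
      refine ⟨fun j => ?_, by simpa using h i⟩
      by_cases hj : j = i
      · subst hj; simp
      · simpa [Function.update_of_ne hj] using h j
    · rintro ⟨h, h'⟩ j
      by_cases hj : j = i
      · subst hj; simpa using h'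
      · simpa [Function.update_of_ne hj] using h j
  rw [this, Measure.prod_prod, stdGaussPi, Measure.pi_pi,
    ← Finset.mul_prod_erase _ _ (Finset.mem_univ i),
    ← Finset.mul_prod_erase _ (fun j => stdGauss (s j)) (Finset.mem_univ i)]
  rw [Function.update_self, measure_univ, one_mul, mul_comm]
  congr 1
  refine Finset.prod_congr rfl fun j hj => ?_
  rw [Function.update_of_ne (Finset.ne_of_mem_erase hj)]

lemma hasDerivAt_gaussianPDFReal (z : ℝ) :
    HasDerivAt (gaussianPDFReal 0 1) (-(z * gaussianPDFReal 0 1 z)) z := by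
  have h : HasDerivAt (fun x : ℝ => -(x - 0) ^ 2 / (2 * ((1 : NNReal) : ℝ))) (-z) z := by
    have := (((hasDerivAt_id z).sub_const 0).pow 2).neg.div_const (2 * ((1 : NNReal) : ℝ))
    exact this.congr_deriv (by simp; ring)
  have h' := h.exp.const_mul (√(2 * Real.pi * ((1 : NNReal) : ℝ)))⁻¹
  refine h'.congr_deriv ?_
  rw [gaussianPDFReal]
  ring

lemma integrable_stdGauss_iff (f : ℝ → ℝ) :
    Integrable f stdGauss ↔ Integrable (fun z => gaussianPDFReal 0 1 z * f z) volume := by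
  rw [stdGauss_eq_withDensity, integrable_withDensity_iff_integrable_smul'
    (measurable_gaussianPDFReal 0 1).ennreal_ofReal (ae_of_all _ fun _ => ENNReal.ofReal_lt_top)]
  simp only [smul_eq_mul, ENNReal.toReal_ofReal (gaussianPDFReal_nonneg 0 1 _)]

lemma integral_stdGauss (f : ℝ → ℝ) :
    ∫ z, f z ∂stdGauss = ∫ z, gaussianPDFReal 0 1 z * f z :=
  integral_gaussianReal_eq_integral_smul one_ne_zero

/-- **Stein's lemma** in dimension one. -/
lemma integral_id_mul_stdGauss {f f' : ℝ → ℝ} (hf : ∀ z, HasDerivAt f (f' z) z)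
    (hfi : Integrable f stdGauss) (hzf : Integrable (fun z => z * f z) stdGauss)
    (hf'i : Integrable f' stdGauss) :
    ∫ z, z * f z ∂stdGauss = ∫ z, f' z ∂stdGauss := by
  rw [integrable_stdGauss_iff] at hfi hzf hf'i
  have h := integral_mul_deriv_eq_deriv_mul_of_integrable (u := f) (u' := f')
    (v := gaussianPDFReal 0 1) (v' := fun z => -(z * gaussianPDFReal 0 1 z))
    (fun z _ => hf z) (fun z _ => hasDerivAt_gaussianPDFReal z)
    (by convert hzf.neg using 1; ext z; simp; ring)
    (by convert hf'i using 1; ext z; simp; ring)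
    (by convert hfi using 1; ext z; simp; ring)
  rw [integral_stdGauss, integral_stdGauss]
  have e1 (z : ℝ) : gaussianPDFReal 0 1 z * (z * f z) = -(f z * -(z * gaussianPDFReal 0 1 z)) := by
    ring
  simp_rw [e1, integral_neg, h, neg_neg, mul_comm]

open Classical in
/-- **Stein's lemma** for one coordinate of a standard Gaussian vector and a bounded function with
bounded partial derivative. -/
lemma integral_eval_mul_stdGaussPi {G G' : (ι → ℝ) → ℝ} (i : ι) (hG : Measurable G)
    (hG' : Measurable G') {C C' : ℝ} (hC : ∀ y, |G y| ≤ C) (hC' : ∀ y, |G' y| ≤ C')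
    (hd : ∀ y s, HasDerivAt (fun r => G (Function.update y i r)) (G' (Function.update y i s)) s) :
    ∫ z, z i * G z ∂stdGaussPi ι = ∫ z, G' z ∂stdGaussPi ι := by
  have hmp := measurePreserving_update_stdGaussPi i
  have h1 : Integrable (fun z : ι → ℝ => z i * G z) (stdGaussPi ι) :=
    ((memLp_eval_stdGaussPi i).integrable one_le_two).mul_bdd (c := C) hG.aestronglyMeasurable
      (ae_of_all _ hC)
  have h2 : Integrable G' (stdGaussPi ι) :=
    Integrable.of_bound hG'.aestronglyMeasurable C' (ae_of_all _ hC')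
  have hu (y : ι → ℝ) : Measurable (fun r => Function.update y i r) := measurable_update y
  rw [← hmp.map_eq] at h1 h2
  conv_lhs => rw [← hmp.map_eq]
  conv_rhs => rw [← hmp.map_eq]
  rw [integral_map hmp.measurable.aemeasurable h1.aestronglyMeasurable,
    integral_map hmp.measurable.aemeasurable h2.aestronglyMeasurable,
    integral_prod (fun p : (ι → ℝ) × ℝ => Function.update p.1 i p.2 i *
      G (Function.update p.1 i p.2)) (h1.comp_measurable hmp.measurable),
    integral_prod (fun p : (ι → ℝ) × ℝ => G' (Function.update p.1 i p.2))
      (h2.comp_measurable hmp.measurable)]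
  refine integral_congr_ae (ae_of_all _ fun y => ?_)
  simp only [Function.update_self]
  refine integral_id_mul_stdGauss (hd y) ?_ ?_ ?_
  · exact Integrable.of_bound (hG.comp (hu y)).aestronglyMeasurable C (ae_of_all _ fun _ => hC _)
  · exact ((memLp_id_gaussianReal (μ := 0) (v := 1) 2).integrable one_le_two).mul_bdd (c := C)
      (hG.comp (hu y)).aestronglyMeasurable (ae_of_all _ fun _ => hC _)
  · exact Integrable.of_bound (hG'.comp (hu y)).aestronglyMeasurable C'
      (ae_of_all _ fun _ => hC' _)

end Pi

/-! ### Essentially bounded measurable functions -/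

lemma MeasureTheory.Integrable.fun_sub {α : Type*} [MeasurableSpace α] {μ : Measure α}
    {f g : α → ℝ} (hf : Integrable f μ) (hg : Integrable g μ) :
    Integrable (fun x => f x - g x) μ :=
  hf.sub hg

/-- A measurable real function that is almost everywhere bounded. -/
def EssBdd {α : Type*} [MeasurableSpace α] (μ : Measure α) (f : α → ℝ) : Prop :=
  Measurable f ∧ ∃ C, ∀ᵐ x ∂μ, |f x| ≤ C

namespace EssBdd

variable {α β : Type*} [MeasurableSpace α] [MeasurableSpace β] {μ : Measure α} {ν : Measure β}
  {f g : α → ℝ}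

lemma mul (hf : EssBdd μ f) (hg : EssBdd μ g) : EssBdd μ (fun x => f x * g x) := by
  obtain ⟨hfm, C, hC⟩ := hf
  obtain ⟨hgm, D, hD⟩ := hg
  refine ⟨hfm.mul hgm, C * D, ?_⟩
  filter_upwards [hC, hD] with x h1 h2
  rw [abs_mul]
  exact mul_le_mul h1 h2 (abs_nonneg _) ((abs_nonneg _).trans h1)

lemma sub (hf : EssBdd μ f) (hg : EssBdd μ g) : EssBdd μ (fun x => f x - g x) := by
  obtain ⟨hfm, C, hC⟩ := hf
  obtain ⟨hgm, D, hD⟩ := hg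
  refine ⟨hfm.sub hgm, C + D, ?_⟩
  filter_upwards [hC, hD] with x h1 h2
  exact (abs_sub _ _).trans (add_le_add h1 h2)

lemma const_one : EssBdd μ (fun _ => (1 : ℝ)) :=
  ⟨measurable_const, 1, ae_of_all _ fun _ => by simp⟩

lemma comp {t : β → α} (hf : EssBdd μ f) (ht : Measurable t) (hac : ν.map t ≪ μ) :
    EssBdd ν (fun y => f (t y)) := by
  obtain ⟨hfm, C, hC⟩ := hf
  exact ⟨hfm.comp ht, C, ae_of_ae_map ht.aemeasurable (hac.ae_le hC)⟩

lemma memLp [IsFiniteMeasure μ] (hf : EssBdd μ f) : MemLp f 2 μ :=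
  hf.2.elim fun C hC => MemLp.of_bound hf.1.aestronglyMeasurable C hC

lemma integrable [IsFiniteMeasure μ] (hf : EssBdd μ f) : Integrable f μ :=
  hf.memLp.integrable one_le_two

lemma integrable_mul (hf : EssBdd μ f) (hg : Integrable g μ) :
    Integrable (fun x => g x * f x) μ :=
  hf.2.elim fun _ hC => hg.mul_bdd hf.1.aestronglyMeasurable hC

lemma memLp_mul (hf : EssBdd μ f) (hg : MemLp g 2 μ) : MemLp (fun x => g x * f x) 2 μ := by
  obtain ⟨hfm, C, hC⟩ := hf
  refine MemLp.of_le_mul (c := C) hg (hg.1.mul hfm.aestronglyMeasurable) ?_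
  filter_upwards [hC] with x hx
  rw [norm_mul, mul_comm]
  exact mul_le_mul_of_nonneg_right hx (norm_nonneg _)

end EssBdd

/-! ### The Gaussian channel with a bounded signal -/

section Channel

variable {E ι : Type*}

/-- The likelihood ratio of the observation `y = θ x + z`, with `z` a standard Gaussian vector,
with respect to the law of `z`. -/
noncomputable def chanWt [Fintype ι] (θ : E → ι → ℝ) (x : E) (y : ι → ℝ) : ℝ :=
  Real.exp (∑ i, (θ x i * y i - θ x i ^ 2 / 2))

lemma chanWt_pos [Fintype ι] (θ : E → ι → ℝ) (x : E) (y : ι → ℝ) : 0 < chanWt θ x y :=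
  Real.exp_pos _

variable [MeasurableSpace E]

/-- The input law has almost surely bounded signal `θ`. -/
structure BoundedSignal (π : Measure E) (θ : E → ι → ℝ) (B : ℝ) : Prop where
  measurable : Measurable θ
  bound : ∀ᵐ x ∂π, ∀ i, |θ x i| ≤ B

namespace BoundedSignal

variable {π : Measure E} {θ : E → ι → ℝ} {B : ℝ}

lemma essBdd (h : BoundedSignal π θ B) (i : ι) : EssBdd π (fun x => θ x i) :=
  ⟨(measurable_pi_apply i).comp h.measurable, B, h.bound.mono fun _ hx => hx i⟩

lemma measurable_obs (h : BoundedSignal π θ B) :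
    Measurable (fun p : E × (ι → ℝ) => θ p.1 + p.2) :=
  (h.measurable.comp measurable_fst).add measurable_snd

end BoundedSignal

variable [Fintype ι]

lemma measurable_chanWt {θ : E → ι → ℝ} (hθ : Measurable θ) :
    Measurable (fun p : E × (ι → ℝ) => chanWt θ p.1 p.2) := by
  unfold chanWt
  fun_prop

namespace BoundedSignal

variable {π : Measure E} {θ : E → ι → ℝ} {B : ℝ}

lemma essBdd_input_prod {f : E → ℝ} (hf : EssBdd π f) :
    EssBdd (π.prod (stdGaussPi ι)) (fun p => f p.1) :=
  hf.comp measurable_fst (by simp [Measure.AbsolutelyContinuous.rfl])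

lemma measurable_chanWt_left (h : BoundedSignal π θ B) (y : ι → ℝ) :
    Measurable (fun x => chanWt θ x y) :=
  (measurable_chanWt h.measurable).comp measurable_prodMk_right

lemma chanWt_le (h : BoundedSignal π θ B) :
    ∀ᵐ x ∂π, ∀ y, chanWt θ x y ≤ Real.exp (∑ i, B * |y i|) := by
  filter_upwards [h.bound] with x hx y
  refine Real.exp_le_exp.mpr (Finset.sum_le_sum fun i _ => ?_)
  have h1 : θ x i * y i ≤ |θ x i| * |y i| := (le_abs_self _).trans (abs_mul _ _).le
  have h2 := mul_le_mul_of_nonneg_right (hx i) (abs_nonneg (y i))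
  nlinarith [sq_nonneg (θ x i)]

lemma essBdd_chanWt (h : BoundedSignal π θ B) (y : ι → ℝ) : EssBdd π (fun x => chanWt θ x y) :=
  ⟨h.measurable_chanWt_left y, _, h.chanWt_le.mono fun x hx => by
    rw [abs_of_pos (chanWt_pos _ _ _)]; exact hx y⟩

end BoundedSignal

/-- The posterior law of the input of the Gaussian channel, given the observation. -/
noncomputable def chanPost (π : Measure E) [IsProbabilityMeasure π] (θ : E → ι → ℝ) :
    Kernel (ι → ℝ) E :=
  Kernel.withDensity (Kernel.const _ π)
    (fun y x => ENNReal.ofReal (chanWt θ x y / ∫ x', chanWt θ x' y ∂π))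

/-- The posterior mean of `g` given the observation `y`. -/
noncomputable def chanAvg (π : Measure E) [IsProbabilityMeasure π] (θ : E → ι → ℝ) (g : E → ℝ)
    (y : ι → ℝ) : ℝ :=
  ∫ x, g x ∂chanPost π θ y

namespace BoundedSignal

variable {π : Measure E} [IsProbabilityMeasure π] {θ : E → ι → ℝ} {B : ℝ}

lemma part_pos (h : BoundedSignal π θ B) (y : ι → ℝ) : 0 < ∫ x, chanWt θ x y ∂π :=
  integral_exp_pos (h.essBdd_chanWt y).integrable

lemma measurable_density (h : BoundedSignal π θ B) :
    Measurable (Function.uncurry fun (y : ι → ℝ) x =>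
      ENNReal.ofReal (chanWt θ x y / ∫ x', chanWt θ x' y ∂π)) := by
  have h1 : Measurable (fun p : (ι → ℝ) × E => chanWt θ p.2 p.1) :=
    (measurable_chanWt h.measurable).comp measurable_swap
  have h2 : Measurable (fun y : ι → ℝ => ∫ x', chanWt θ x' y ∂π) :=
    (StronglyMeasurable.integral_prod_right (f := fun y x => chanWt θ x y)
      h1.stronglyMeasurable).measurable
  exact (h1.div (h2.comp measurable_fst)).ennreal_ofReal

lemma chanPost_apply (h : BoundedSignal π θ B) (y : ι → ℝ) :
    chanPost π θ y = π.withDensity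
      (fun x => ENNReal.ofReal (chanWt θ x y / ∫ x', chanWt θ x' y ∂π)) := by
  rw [chanPost, Kernel.withDensity_apply _ h.measurable_density, Kernel.const_apply]

lemma isMarkovKernel_chanPost (h : BoundedSignal π θ B) : IsMarkovKernel (chanPost π θ) := by
  refine ⟨fun y => ⟨?_⟩⟩
  rw [h.chanPost_apply, withDensity_apply _ MeasurableSet.univ, setLIntegral_univ,
    ← ofReal_integral_eq_lintegral_ofReal ((h.essBdd_chanWt y).integrable.div_const _)
      (ae_of_all _ fun x => div_nonneg (chanWt_pos _ _ _).le (h.part_pos y).le),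
    integral_div, div_self (h.part_pos y).ne', ENNReal.ofReal_one]

lemma chanPost_absolutelyContinuous (h : BoundedSignal π θ B) (y : ι → ℝ) :
    chanPost π θ y ≪ π := by
  rw [h.chanPost_apply]
  exact withDensity_absolutelyContinuous _ _

lemma chanAvg_eq (h : BoundedSignal π θ B) (g : E → ℝ) (y : ι → ℝ) :
    chanAvg π θ g y = (∫ x, g x * chanWt θ x y ∂π) / ∫ x, chanWt θ x y ∂π := by
  rw [chanAvg, h.chanPost_apply, integral_withDensity_eq_integral_toReal_smul
    (((h.measurable_chanWt_left y).div_const _).ennreal_ofReal)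
    (ae_of_all _ fun _ => ENNReal.ofReal_lt_top), ← integral_div]
  refine integral_congr_ae (ae_of_all _ fun x => ?_)
  simp only [smul_eq_mul]
  rw [ENNReal.toReal_ofReal (div_nonneg (chanWt_pos _ _ _).le (h.part_pos y).le)]
  ring

lemma measurable_chanAvg (h : BoundedSignal π θ B) {g : E → ℝ} (hg : Measurable g) :
    Measurable (chanAvg π θ g) :=
  have := h.isMarkovKernel_chanPost
  (StronglyMeasurable.integral_kernel hg.stronglyMeasurable).measurable

lemma abs_chanAvg_le (h : BoundedSignal π θ B) {g : E → ℝ} {C : ℝ} (hC : ∀ᵐ x ∂π, |g x| ≤ C)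
    (y : ι → ℝ) : |chanAvg π θ g y| ≤ C := by
  have := h.isMarkovKernel_chanPost
  have := norm_integral_le_of_norm_le_const (f := g)
    ((h.chanPost_absolutelyContinuous y).ae_le hC)
  simpa [chanAvg] using this

lemma exists_abs_chanAvg_le (h : BoundedSignal π θ B) {g : E → ℝ} (hg : EssBdd π g) :
    ∃ C, ∀ y, |chanAvg π θ g y| ≤ C :=
  hg.2.imp fun _ hC => h.abs_chanAvg_le hC

lemma integrable_chanWt (h : BoundedSignal π θ B) :
    Integrable (fun p : E × (ι → ℝ) => chanWt θ p.1 p.2) (π.prod (stdGaussPi ι)) := by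
  rw [integrable_prod_iff (measurable_chanWt h.measurable).aestronglyMeasurable]
  constructor
  · refine ae_of_all _ fun x => ?_
    simp only [chanWt, Real.exp_sum]
    exact Integrable.fintype_prod fun i => integrable_exp_stdGauss (θ x i)
  · have h1 (x : E) : ∫ y, ‖chanWt θ x y‖ ∂stdGaussPi ι = 1 := by
      have := integral_stdGaussPi_const_add (θ x) (fun _ => 1)
      simp only [integral_const, probReal_univ, smul_eq_mul, mul_one] at this
      rw [this]
      exact integral_congr_ae (ae_of_all _ fun y => abs_of_pos (chanWt_pos θ x y))
    simp only [h1]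
    exact integrable_const _

lemma integral_mul_obs (h : BoundedSignal π θ B) {φ : E → ℝ} (hφ : EssBdd π φ)
    {K : (ι → ℝ) → ℝ} (hK : Measurable K) {C : ℝ} (hC : ∀ y, |K y| ≤ C) :
    ∫ p, φ p.1 * K (θ p.1 + p.2) ∂π.prod (stdGaussPi ι)
      = ∫ y, K y * ∫ x, φ x * chanWt θ x y ∂π ∂stdGaussPi ι := by
  have hφ' := essBdd_input_prod (ι := ι) hφ
  have hK' : EssBdd (π.prod (stdGaussPi ι)) (fun p : E × (ι → ℝ) => K (θ p.1 + p.2)) :=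
    ⟨hK.comp h.measurable_obs, C, ae_of_all _ fun _ => hC _⟩
  have hK'' : EssBdd (π.prod (stdGaussPi ι)) (fun p : E × (ι → ℝ) => K p.2) :=
    ⟨hK.comp measurable_snd, C, ae_of_all _ fun _ => hC _⟩
  rw [integral_prod _ (hφ'.mul hK').integrable]
  have h1 (x : E) : ∫ z, φ x * K (θ x + z) ∂stdGaussPi ι
      = ∫ y, chanWt θ x y * (φ x * K y) ∂stdGaussPi ι :=
    integral_stdGaussPi_const_add (θ x) (fun y => φ x * K y)
  simp_rw [h1]
  rw [integral_integral_swap ((hφ'.mul hK'').integrable_mul h.integrable_chanWt)]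
  refine integral_congr_ae (ae_of_all _ fun y => ?_)
  simp only
  rw [← integral_const_mul]
  exact integral_congr_ae (ae_of_all _ fun x => by ring)

/-- The **Nishimori identity**: the hidden input may be replaced by its posterior mean. -/
lemma nishimori (h : BoundedSignal π θ B) {φ : E → ℝ} (hφ : EssBdd π φ)
    {K : (ι → ℝ) → ℝ} (hK : Measurable K) (hC : ∃ C, ∀ y, |K y| ≤ C) :
    ∫ p, φ p.1 * K (θ p.1 + p.2) ∂π.prod (stdGaussPi ι)
      = ∫ p, chanAvg π θ φ (θ p.1 + p.2) * K (θ p.1 + p.2) ∂π.prod (stdGaussPi ι) := by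
  obtain ⟨C, hC⟩ := hC
  obtain ⟨D, hD⟩ := h.exists_abs_chanAvg_le hφ
  have h1 := h.integral_mul_obs EssBdd.const_one (K := fun y => chanAvg π θ φ y * K y)
    ((h.measurable_chanAvg hφ.1).mul hK) (C := D * C) fun y => by
      rw [abs_mul]
      exact mul_le_mul (hD y) (hC y) (abs_nonneg _) ((abs_nonneg _).trans (hD y))
  simp only [one_mul] at h1
  rw [h.integral_mul_obs hφ hK hC, h1]
  refine integral_congr_ae (ae_of_all _ fun y => ?_)
  simp only
  rw [h.chanAvg_eq]
  have := (h.part_pos y).ne'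
  field_simp

open Classical in
lemma hasDerivAt_integral_mul_chanWt (h : BoundedSignal π θ B) {g : E → ℝ} (hg : EssBdd π g)
    (i : ι) (y : ι → ℝ) (s : ℝ) :
    HasDerivAt (fun r => ∫ x, g x * chanWt θ x (Function.update y i r) ∂π)
      (∫ x, g x * θ x i * chanWt θ x (Function.update y i s) ∂π) s := by
  obtain ⟨C, hC⟩ := hg.2
  refine (hasDerivAt_integral_of_dominated_loc_of_deriv_le
    (F' := fun r x => g x * θ x i * chanWt θ x (Function.update y i r))
    (bound := fun _ => C * B * Real.exp (∑ j, B * (|y j| + (|s| + 1))))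
    (Metric.ball_mem_nhds s one_pos)
    (Filter.Eventually.of_forall fun r =>
      (hg.mul (h.essBdd_chanWt _)).1.aestronglyMeasurable)
    (hg.mul (h.essBdd_chanWt _)).integrable
    ((hg.mul (h.essBdd i)).mul (h.essBdd_chanWt _)).1.aestronglyMeasurable
    ?_ (integrable_const _) ?_).2
  · filter_upwards [hC, h.bound, h.chanWt_le] with x h1 h2 h3 r hr
    rw [norm_mul, norm_mul, Real.norm_eq_abs, Real.norm_eq_abs, Real.norm_eq_abs,
      abs_of_pos (chanWt_pos _ _ _)]
    have hB : 0 ≤ B := (abs_nonneg _).trans (h2 i)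
    have hC0 : 0 ≤ C := (abs_nonneg _).trans h1
    refine mul_le_mul (mul_le_mul h1 (h2 i) (abs_nonneg _) hC0) ((h3 _).trans ?_)
      (chanWt_pos _ _ _).le (mul_nonneg hC0 hB)
    refine Real.exp_le_exp.mpr (Finset.sum_le_sum fun j _ => mul_le_mul_of_nonneg_left ?_ hB)
    by_cases hj : j = i
    · subst hj
      rw [Function.update_self]
      have h4 : |r - s| < 1 := by simpa [Real.dist_eq] using hr
      have h5 := abs_add_le (r - s) s
      rw [sub_add_cancel] at h5
      have := abs_nonneg (y j)
      linarith
    · rw [Function.update_of_ne hj]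
      have := abs_nonneg s
      linarith
  · refine ae_of_all _ fun x r _ => ?_
    have h1 : HasDerivAt (fun r => ∑ j, (θ x j * Function.update y i r j - θ x j ^ 2 / 2))
        (θ x i) r := by
      have h2 : HasDerivAt (fun r => ∑ j, (θ x j * Function.update y i r j - θ x j ^ 2 / 2))
          (∑ j, θ x j * (Pi.single i (1 : ℝ) : ι → ℝ) j) r :=
        HasDerivAt.fun_sum fun j _ =>
          ((hasDerivAt_pi.1 (hasDerivAt_update y i r) j).const_mul (θ x j)).sub_const _
      simpa [Pi.single_apply] using h2
    refine (h1.exp.const_mul (g x)).congr_deriv ?_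
    simp only [chanWt]
    ring

open Classical in
lemma hasDerivAt_chanAvg (h : BoundedSignal π θ B) {g : E → ℝ} (hg : EssBdd π g)
    (i : ι) (y : ι → ℝ) (s : ℝ) :
    HasDerivAt (fun r => chanAvg π θ g (Function.update y i r))
      (chanAvg π θ (fun x => g x * θ x i) (Function.update y i s)
        - chanAvg π θ g (Function.update y i s)
          * chanAvg π θ (fun x => θ x i) (Function.update y i s)) s := by
  have h1 := h.hasDerivAt_integral_mul_chanWt hg i y s
  have h2 := h.hasDerivAt_integral_mul_chanWt EssBdd.const_one i y s
  simp only [one_mul] at h2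
  have h0 := (h.part_pos (Function.update y i s)).ne'
  simp only [h.chanAvg_eq]
  refine (h1.div h2 h0).congr_deriv ?_
  field_simp

/-- Gaussian integration by parts for a posterior mean. -/
lemma integral_noise_mul_chanAvg (h : BoundedSignal π θ B) {g : E → ℝ} (hg : EssBdd π g)
    (i : ι) (a : ι → ℝ) :
    ∫ z, z i * chanAvg π θ g (a + z) ∂stdGaussPi ι
      = ∫ z, (chanAvg π θ (fun x => g x * θ x i) (a + z)
          - chanAvg π θ g (a + z) * chanAvg π θ (fun x => θ x i) (a + z)) ∂stdGaussPi ι := by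
  classical
  obtain ⟨C, hC⟩ := h.exists_abs_chanAvg_le hg
  obtain ⟨D, hD⟩ := h.exists_abs_chanAvg_le (h.essBdd i)
  obtain ⟨F, hF⟩ := h.exists_abs_chanAvg_le (hg.mul (h.essBdd i))
  have ha : Measurable (fun z : ι → ℝ => a + z) := measurable_const_add a
  have hm {g : E → ℝ} (hg : EssBdd π g) : Measurable (fun z => chanAvg π θ g (a + z)) :=
    (h.measurable_chanAvg hg.1).comp ha
  refine integral_eval_mul_stdGaussPi (G := fun z => chanAvg π θ g (a + z))
    (G' := fun z => chanAvg π θ (fun x => g x * θ x i) (a + z)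
          - chanAvg π θ g (a + z) * chanAvg π θ (fun x => θ x i) (a + z))
    i (hm hg) ((hm (hg.mul (h.essBdd i))).sub ((hm hg).mul (hm (h.essBdd i))))
    (C := C) (C' := F + C * D) (fun z => hC _) (fun z => ?_) fun y s => ?_
  · refine (abs_sub _ _).trans (add_le_add (hF _) ?_)
    rw [abs_mul]
    exact mul_le_mul (hC _) (hD _) (abs_nonneg _) ((abs_nonneg _).trans (hC (a + z)))
  · have hu (r : ℝ) : a + Function.update y i r = Function.update (a + y) i (a i + r) := by
      ext j
      by_cases hj : j = i
      · subst hj; simp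
      · simp [Function.update_of_ne hj]
    simp only [hu]
    exact (h.hasDerivAt_chanAvg hg i (a + y) (a i + s)).comp_const_add (a i) s

lemma memLp_noise_prod (i : ι) :
    MemLp (fun p : E × (ι → ℝ) => p.2 i) 2 (π.prod (stdGaussPi ι)) :=
  (memLp_eval_stdGaussPi i).comp_measurePreserving measurePreserving_snd

lemma essBdd_chanAvg_obs (h : BoundedSignal π θ B) {g : E → ℝ} (hg : EssBdd π g) :
    EssBdd (π.prod (stdGaussPi ι)) (fun p => chanAvg π θ g (θ p.1 + p.2)) :=
  ⟨(h.measurable_chanAvg hg.1).comp h.measurable_obs,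
    (h.exists_abs_chanAvg_le hg).imp fun _ hC => ae_of_all _ fun _ => hC _⟩

lemma exists_abs_mul_le {α : Type*} {f g : α → ℝ} (hf : ∃ C, ∀ y, |f y| ≤ C)
    (hg : ∃ C, ∀ y, |g y| ≤ C) : ∃ C, ∀ y, |(f * g) y| ≤ C := by
  obtain ⟨C, hC⟩ := hf
  obtain ⟨D, hD⟩ := hg
  refine ⟨C * D, fun y => ?_⟩
  rw [Pi.mul_apply, abs_mul]
  exact mul_le_mul (hC y) (hD y) (abs_nonneg _) ((abs_nonneg _).trans (hC y))

lemma integral_input_mul_noise_mul_chanAvg (h : BoundedSignal π θ B) {f g : E → ℝ}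
    (hf : EssBdd π f) (hg : EssBdd π g) (i : ι) :
    ∫ p, f p.1 * p.2 i * chanAvg π θ g (θ p.1 + p.2) ∂π.prod (stdGaussPi ι)
      = ∫ p, f p.1 * (chanAvg π θ (fun x => g x * θ x i) (θ p.1 + p.2)
          - chanAvg π θ g (θ p.1 + p.2) * chanAvg π θ (fun x => θ x i) (θ p.1 + p.2))
          ∂π.prod (stdGaussPi ι) := by
  have hfi := essBdd_input_prod (ι := ι) hf
  have h1 : Integrable (fun p : E × (ι → ℝ) => p.2 i) (π.prod (stdGaussPi ι)) :=
    memLp_noise_prod i |>.integrable one_le_two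
  have h2 : Integrable (fun p : E × (ι → ℝ) => f p.1 * p.2 i * chanAvg π θ g (θ p.1 + p.2))
      (π.prod (stdGaussPi ι)) := by
    have := (h.essBdd_chanAvg_obs hg).integrable_mul (hfi.integrable_mul h1)
    simpa only [mul_comm (f _)] using this
  rw [integral_prod _ h2, integral_prod _ (hfi.mul ((h.essBdd_chanAvg_obs (hg.mul
    (h.essBdd i))).sub ((h.essBdd_chanAvg_obs hg).mul (h.essBdd_chanAvg_obs
    (h.essBdd i))))).integrable]
  refine integral_congr_ae (ae_of_all _ fun x => ?_)
  simp only [mul_assoc]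
  rw [integral_const_mul, integral_const_mul, h.integral_noise_mul_chanAvg hg]

/-- The joint law of the input, the noise, and a posterior sample. -/
noncomputable def joint (h : BoundedSignal π θ B) : Measure ((E × (ι → ℝ)) × E) :=
  (π.prod (stdGaussPi ι)) ⊗ₘ (chanPost π θ).comap (fun p => θ p.1 + p.2) h.measurable_obs

lemma map_fst_joint (h : BoundedSignal π θ B) :
    h.joint.map Prod.fst = π.prod (stdGaussPi ι) :=
  have := h.isMarkovKernel_chanPost
  Measure.fst_compProd _ _

lemma isProbabilityMeasure_joint (h : BoundedSignal π θ B) : IsProbabilityMeasure h.joint :=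
  have := h.isMarkovKernel_chanPost
  inferInstanceAs (IsProbabilityMeasure (_ ⊗ₘ _))

lemma map_snd_joint_absolutelyContinuous (h : BoundedSignal π θ B) :
    h.joint.map Prod.snd ≪ π := by
  have := h.isMarkovKernel_chanPost
  refine Measure.AbsolutelyContinuous.mk fun s hs h0 => ?_
  rw [Measure.map_apply measurable_snd hs, joint, Measure.compProd_apply (measurable_snd hs)]
  refine (lintegral_congr fun p => ?_).trans lintegral_zero
  exact h.chanPost_absolutelyContinuous _ h0

lemma essBdd_fst (h : BoundedSignal π θ B) {F : E × (ι → ℝ) → ℝ}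
    (hF : EssBdd (π.prod (stdGaussPi ι)) F) : EssBdd h.joint (fun q => F q.1) :=
  hF.comp measurable_fst (by rw [h.map_fst_joint])

lemma essBdd_snd (h : BoundedSignal π θ B) {g : E → ℝ} (hg : EssBdd π g) :
    EssBdd h.joint (fun q => g q.2) :=
  hg.comp measurable_snd h.map_snd_joint_absolutelyContinuous

lemma essBdd_input (h : BoundedSignal π θ B) {g : E → ℝ} (hg : EssBdd π g) :
    EssBdd h.joint (fun q => g q.1.1) :=
  h.essBdd_fst (essBdd_input_prod hg)

lemma memLp_noise (h : BoundedSignal π θ B) (i : ι) :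
    MemLp (fun q : (E × (ι → ℝ)) × E => q.1.2 i) 2 h.joint :=
  (memLp_noise_prod i).comp_measurePreserving ⟨measurable_fst, h.map_fst_joint⟩

lemma integral_joint (h : BoundedSignal π θ B) {A : (E × (ι → ℝ)) × E → ℝ}
    (hA : Integrable A h.joint) :
    ∫ q, A q ∂h.joint
      = ∫ p, chanAvg π θ (fun x => A (p, x)) (θ p.1 + p.2) ∂π.prod (stdGaussPi ι) :=
  have := h.isMarkovKernel_chanPost
  Measure.integral_compProd hA

lemma integrable_chanAvg_of_joint (h : BoundedSignal π θ B) {A : (E × (ι → ℝ)) × E → ℝ}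
    (hA : Integrable A h.joint) :
    Integrable (fun p => chanAvg π θ (fun x => A (p, x)) (θ p.1 + p.2))
      (π.prod (stdGaussPi ι)) :=
  have := h.isMarkovKernel_chanPost
  Integrable.integral_compProd hA

lemma integral_mul_joint (h : BoundedSignal π θ B) {F : E × (ι → ℝ) → ℝ} {g : E → ℝ}
    (hA : Integrable (fun q => F q.1 * g q.2) h.joint) :
    ∫ q, F q.1 * g q.2 ∂h.joint
      = ∫ p, F p * chanAvg π θ g (θ p.1 + p.2) ∂π.prod (stdGaussPi ι) := by
  rw [h.integral_joint hA]
  simp only [chanAvg, integral_const_mul]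

lemma integral_sample_mul_noise (h : BoundedSignal π θ B) (i : ι) :
    ∫ q, q.1.2 i * θ q.2 i ∂h.joint
      = ∫ q, θ q.2 i * θ q.2 i ∂h.joint - ∫ q, θ q.1.1 i * θ q.2 i ∂h.joint := by
  have hp := h.isProbabilityMeasure_joint
  have hi := h.essBdd i
  have hm := h.measurable_chanAvg hi.1
  have e1 := h.integral_input_mul_noise_mul_chanAvg EssBdd.const_one hi i
  have e2 := h.integral_mul_joint (F := fun _ => 1) (g := fun x => θ x i * θ x i)
    ((EssBdd.const_one.mul (h.essBdd_snd (hi.mul hi))).integrable)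
  have e3 := h.integral_mul_joint (F := fun p => θ p.1 i) (g := fun x => θ x i)
    ((h.essBdd_input hi).mul (h.essBdd_snd hi)).integrable
  have e4 := h.nishimori hi hm (h.exists_abs_chanAvg_le hi)
  simp only [one_mul] at e1 e2
  rw [h.integral_mul_joint (F := fun p => p.2 i) (g := fun x => θ x i)
    (((h.essBdd_snd hi).memLp_mul (h.memLp_noise i)).integrable one_le_two), e1, e2, e3, e4,
    integral_sub (h.essBdd_chanAvg_obs (hi.mul hi)).integrable
      ((h.essBdd_chanAvg_obs hi).mul (h.essBdd_chanAvg_obs hi)).integrable]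

lemma integral_overlap_mul_sample_mul_noise (h : BoundedSignal π θ B) (i j : ι) :
    ∫ q, θ q.1.1 j * q.1.2 i * (θ q.2 j * θ q.2 i) ∂h.joint
      = ∫ q, θ q.1.1 j * (θ q.2 j * θ q.2 i * θ q.2 i) ∂h.joint
        - ∫ p, (θ p.1 j * chanAvg π θ (fun x => θ x j) (θ p.1 + p.2))
          * (θ p.1 i * chanAvg π θ (fun x => θ x i) (θ p.1 + p.2)) ∂π.prod (stdGaussPi ι) := by
  have hp := h.isProbabilityMeasure_joint
  have hi := h.essBdd i
  have hj := h.essBdd j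
  have hji := hj.mul hi
  have oi := h.essBdd_chanAvg_obs hi
  have ojii := h.essBdd_chanAvg_obs (hji.mul hi)
  have oji := h.essBdd_chanAvg_obs hji
  have tj := essBdd_input_prod (ι := ι) hj
  have e1 := h.integral_input_mul_noise_mul_chanAvg hj hji i
  have e2 := h.integral_mul_joint (F := fun p => θ p.1 j) (g := fun x => θ x j * θ x i * θ x i)
    ((h.essBdd_input hj).mul (h.essBdd_snd (hji.mul hi))).integrable
  have e3 := h.nishimori hj ((h.measurable_chanAvg hji.1).mul (h.measurable_chanAvg hi.1))
    (exists_abs_mul_le (h.exists_abs_chanAvg_le hji) (h.exists_abs_chanAvg_le hi))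
  have e4 := h.nishimori hji ((h.measurable_chanAvg hj.1).mul (h.measurable_chanAvg hi.1))
    (exists_abs_mul_le (h.exists_abs_chanAvg_le hj) (h.exists_abs_chanAvg_le hi))
  have hint : Integrable (fun q : (E × (ι → ℝ)) × E =>
      θ q.1.1 j * q.1.2 i * (θ q.2 j * θ q.2 i)) h.joint := by
    have := ((h.essBdd_snd hji).memLp_mul ((h.essBdd_input hj).memLp_mul
      (h.memLp_noise i))).integrable one_le_two
    exact this.congr (ae_of_all _ fun q => by ring)
  rw [h.integral_mul_joint (F := fun p => θ p.1 j * p.2 i) (g := fun x => θ x j * θ x i) hint,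
    e1, e2]
  simp only [mul_sub]
  rw [integral_sub (tj.mul ojii).integrable (tj.mul (oji.mul oi)).integrable]
  congr 1
  simp only [Pi.mul_apply] at e3 e4
  rw [e3]
  trans ∫ p, chanAvg π θ (fun x => θ x j * θ x i) (θ p.1 + p.2) *
      (chanAvg π θ (fun x => θ x j) (θ p.1 + p.2) *
        chanAvg π θ (fun x => θ x i) (θ p.1 + p.2)) ∂π.prod (stdGaussPi ι)
  · exact integral_congr_ae (ae_of_all _ fun p => by ring)
  · rw [← e4]
    exact integral_congr_ae (ae_of_all _ fun p => by ring)

end BoundedSignal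

/-- The overlap of the input and the posterior sample, restricted to the coordinates in `s`. -/
def chanOverlap (θ : E → ι → ℝ) (s : Finset ι) (q : (E × (ι → ℝ)) × E) : ℝ :=
  ∑ i ∈ s, θ q.1.1 i * θ q.2 i

/-- The derivative of the Hamiltonian with respect to the logarithm of the signal-to-noise ratio
of the coordinates in `s`. -/
noncomputable def chanEnergy (θ : E → ι → ℝ) (s : Finset ι) (q : (E × (ι → ℝ)) × E) : ℝ :=
  ∑ i ∈ s, (θ q.2 i ^ 2 / 2 - θ q.1.1 i * θ q.2 i - θ q.2 i * q.1.2 i / 2)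

/-- The posterior mean of the overlap. -/
noncomputable def chanOverlapAvg (π : Measure E) [IsProbabilityMeasure π] (θ : E → ι → ℝ)
    (s : Finset ι) (p : E × (ι → ℝ)) : ℝ :=
  ∑ i ∈ s, θ p.1 i * chanAvg π θ (fun x => θ x i) (θ p.1 + p.2)

namespace BoundedSignal

variable {π : Measure E} [IsProbabilityMeasure π] {θ : E → ι → ℝ} {B : ℝ}

lemma memLp_overlap (h : BoundedSignal π θ B) (s : Finset ι) :
    MemLp (chanOverlap θ s) 2 h.joint :=
  have := h.isProbabilityMeasure_joint
  memLp_finsetSum s fun i _ =>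
    ((h.essBdd_input (h.essBdd i)).mul (h.essBdd_snd (h.essBdd i))).memLp

lemma memLp_energy (h : BoundedSignal π θ B) (s : Finset ι) :
    MemLp (chanEnergy θ s) 2 h.joint := by
  have := h.isProbabilityMeasure_joint
  refine memLp_finsetSum s fun i _ => ?_
  have hx := h.essBdd_snd (h.essBdd i)
  have h1 : MemLp (fun q : (E × (ι → ℝ)) × E => θ q.2 i ^ 2 / 2) 2 h.joint := by
    convert ((hx.mul hx).memLp).mul_const 2⁻¹ using 2 with q
    ring
  have h2 : MemLp (fun q : (E × (ι → ℝ)) × E => θ q.2 i * q.1.2 i / 2) 2 h.joint := by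
    convert (hx.memLp_mul (h.memLp_noise i)).mul_const 2⁻¹ using 2 with q
    ring
  exact (h1.sub ((h.essBdd_input (h.essBdd i)).mul hx).memLp).sub h2

lemma memLp_overlapAvg (h : BoundedSignal π θ B) (s : Finset ι) :
    MemLp (chanOverlapAvg π θ s) 2 (π.prod (stdGaussPi ι)) :=
  memLp_finsetSum s fun i _ =>
    ((essBdd_input_prod (h.essBdd i)).mul (h.essBdd_chanAvg_obs (h.essBdd i))).memLp

lemma integral_energy (h : BoundedSignal π θ B) (s : Finset ι) :
    ∫ q, chanEnergy θ s q ∂h.joint = -(∫ q, chanOverlap θ s q ∂h.joint) / 2 := by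
  have := h.isProbabilityMeasure_joint
  have hTx (i : ι) : Integrable (fun q => θ q.1.1 i * θ q.2 i) h.joint :=
    ((h.essBdd_input (h.essBdd i)).mul (h.essBdd_snd (h.essBdd i))).integrable
  have hxx (i : ι) : Integrable (fun q => θ q.2 i * θ q.2 i) h.joint :=
    ((h.essBdd_snd (h.essBdd i)).mul (h.essBdd_snd (h.essBdd i))).integrable
  have hzx (i : ι) : Integrable (fun q => q.1.2 i * θ q.2 i) h.joint :=
    ((h.essBdd_snd (h.essBdd i)).memLp_mul (h.memLp_noise i)).integrable one_le_two
  have e (q : (E × (ι → ℝ)) × E) : chanEnergy θ s q = ∑ i ∈ s, (2⁻¹ * (θ q.2 i * θ q.2 i)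
      - θ q.1.1 i * θ q.2 i - 2⁻¹ * (q.1.2 i * θ q.2 i)) :=
    Finset.sum_congr rfl fun i _ => by ring
  simp only [e, chanOverlap]
  rw [integral_finsetSum _ fun i _ => (((hxx i).const_mul _).fun_sub (hTx i)).fun_sub
    ((hzx i).const_mul _), integral_finsetSum _ fun i _ => hTx i, ← Finset.sum_neg_distrib,
    Finset.sum_div]
  refine Finset.sum_congr rfl fun i _ => ?_
  rw [integral_sub (((hxx i).const_mul _).fun_sub (hTx i)) ((hzx i).const_mul _),
    integral_sub ((hxx i).const_mul _) (hTx i), integral_const_mul, integral_const_mul,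
    h.integral_sample_mul_noise]
  ring

lemma integral_overlap_mul_energy (h : BoundedSignal π θ B) (s : Finset ι) :
    ∫ q, chanOverlap θ s q * chanEnergy θ s q ∂h.joint
      = -(∫ q, chanOverlap θ s q ^ 2 ∂h.joint)
        + (∫ p, chanOverlapAvg π θ s p ^ 2 ∂π.prod (stdGaussPi ι)) / 2 := by
  have := h.isProbabilityMeasure_joint
  have T (i : ι) := h.essBdd_input (h.essBdd i)
  have X (i : ι) := h.essBdd_snd (h.essBdd i)
  have i1 (j i : ι) :
      Integrable (fun q => θ q.1.1 j * (θ q.2 j * θ q.2 i * θ q.2 i)) h.joint :=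
    ((T j).mul (((X j).mul (X i)).mul (X i))).integrable
  have i2 (j i : ι) :
      Integrable (fun q => (θ q.1.1 j * θ q.2 j) * (θ q.1.1 i * θ q.2 i)) h.joint :=
    (((T j).mul (X j)).mul ((T i).mul (X i))).integrable
  have i3 (j i : ι) :
      Integrable (fun q => θ q.1.1 j * q.1.2 i * (θ q.2 j * θ q.2 i)) h.joint := by
    have := (((X j).mul (X i)).memLp_mul ((T j).memLp_mul
      (h.memLp_noise i))).integrable one_le_two
    exact this.congr (ae_of_all _ fun q => by ring)
  have i4 (j i : ι) : Integrable (fun p : E × (ι → ℝ) =>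
      (θ p.1 j * chanAvg π θ (fun x => θ x j) (θ p.1 + p.2))
        * (θ p.1 i * chanAvg π θ (fun x => θ x i) (θ p.1 + p.2))) (π.prod (stdGaussPi ι)) := by
    have a (i : ι) := (essBdd_input_prod (h.essBdd i)).mul (h.essBdd_chanAvg_obs (h.essBdd i))
    exact ((a j).mul (a i)).integrable
  have e1 (q : (E × (ι → ℝ)) × E) : chanOverlap θ s q * chanEnergy θ s q
      = ∑ j ∈ s, ∑ i ∈ s, (2⁻¹ * (θ q.1.1 j * (θ q.2 j * θ q.2 i * θ q.2 i))
        - (θ q.1.1 j * θ q.2 j) * (θ q.1.1 i * θ q.2 i)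
        - 2⁻¹ * (θ q.1.1 j * q.1.2 i * (θ q.2 j * θ q.2 i))) := by
    rw [chanOverlap, chanEnergy, Finset.sum_mul_sum]
    exact Finset.sum_congr rfl fun j _ => Finset.sum_congr rfl fun i _ => by ring
  have e2 (q : (E × (ι → ℝ)) × E) : chanOverlap θ s q ^ 2
      = ∑ j ∈ s, ∑ i ∈ s, (θ q.1.1 j * θ q.2 j) * (θ q.1.1 i * θ q.2 i) := by
    rw [chanOverlap, sq, Finset.sum_mul_sum]
  have e3 (p : E × (ι → ℝ)) : chanOverlapAvg π θ s p ^ 2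
      = ∑ j ∈ s, ∑ i ∈ s, (θ p.1 j * chanAvg π θ (fun x => θ x j) (θ p.1 + p.2))
        * (θ p.1 i * chanAvg π θ (fun x => θ x i) (θ p.1 + p.2)) := by
    rw [chanOverlapAvg, sq, Finset.sum_mul_sum]
  simp only [e1, e2, e3]
  have k (j i : ι) := (((i1 j i).const_mul 2⁻¹).fun_sub (i2 j i)).fun_sub ((i3 j i).const_mul 2⁻¹)
  rw [integral_finsetSum _ fun j _ => integrable_finsetSum _ fun i _ => k j i,
    integral_finsetSum _ fun j _ => integrable_finsetSum _ fun i _ => i2 j i,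
    integral_finsetSum _ fun j _ => integrable_finsetSum _ fun i _ => i4 j i,
    ← Finset.sum_neg_distrib, Finset.sum_div, ← Finset.sum_add_distrib]
  refine Finset.sum_congr rfl fun j _ => ?_
  rw [integral_finsetSum _ fun i _ => k j i, integral_finsetSum _ fun i _ => i2 j i,
    integral_finsetSum _ fun i _ => i4 j i,
    ← Finset.sum_neg_distrib, Finset.sum_div, ← Finset.sum_add_distrib]
  refine Finset.sum_congr rfl fun i _ => ?_
  rw [integral_sub (((i1 j i).const_mul _).fun_sub (i2 j i)) ((i3 j i).const_mul _),
    integral_sub ((i1 j i).const_mul _) (i2 j i), integral_const_mul, integral_const_mul,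
    h.integral_overlap_mul_sample_mul_noise]
  ring

/-- Conditional Jensen inequality for the overlap. -/
lemma integral_overlapAvg_sq_le (h : BoundedSignal π θ B) (s : Finset ι) :
    ∫ p, chanOverlapAvg π θ s p ^ 2 ∂π.prod (stdGaussPi ι)
      ≤ ∫ q, chanOverlap θ s q ^ 2 ∂h.joint := by
  have := h.isProbabilityMeasure_joint
  have hmp : MeasurePreserving Prod.fst h.joint (π.prod (stdGaussPi ι)) :=
    ⟨measurable_fst, h.map_fst_joint⟩
  have hq := h.memLp_overlap s
  have ha : MemLp (fun q => chanOverlapAvg π θ s q.1) 2 h.joint :=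
    (h.memLp_overlapAvg s).comp_measurePreserving hmp
  have hqa : Integrable (fun q => chanOverlap θ s q * chanOverlapAvg π θ s q.1) h.joint :=
    hq.integrable_mul ha
  have e1 : ∫ q, chanOverlap θ s q * chanOverlapAvg π θ s q.1 ∂h.joint
      = ∫ p, chanOverlapAvg π θ s p ^ 2 ∂π.prod (stdGaussPi ι) := by
    rw [h.integral_joint hqa]
    refine integral_congr_ae (ae_of_all _ fun p => ?_)
    have hM := h.isMarkovKernel_chanPost
    have hx (i : ι) : Integrable (fun x => θ x i) (chanPost π θ (θ p.1 + p.2)) := by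
      refine EssBdd.integrable ⟨(h.essBdd i).1, (h.essBdd i).2.imp fun C hC => ?_⟩
      exact (h.chanPost_absolutelyContinuous _).ae_le hC
    simp only [chanAvg, chanOverlap]
    rw [integral_mul_const, integral_finsetSum _ fun i _ => (hx i).const_mul _, sq]
    simp only [integral_const_mul]
    rfl
  have e2 : ∫ q, chanOverlapAvg π θ s q.1 ^ 2 ∂h.joint
      = ∫ p, chanOverlapAvg π θ s p ^ 2 ∂π.prod (stdGaussPi ι) := by
    rw [← h.map_fst_joint, integral_map measurable_fst.aemeasurable]
    rw [h.map_fst_joint]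
    exact (h.memLp_overlapAvg s).integrable_sq.aestronglyMeasurable
  have h0 : 0 ≤ ∫ q, (chanOverlap θ s q - chanOverlapAvg π θ s q.1) ^ 2 ∂h.joint :=
    integral_nonneg fun _ => sq_nonneg _
  have e3 (q : (E × (ι → ℝ)) × E) : (chanOverlap θ s q - chanOverlapAvg π θ s q.1) ^ 2
      = chanOverlap θ s q ^ 2 - 2 * (chanOverlap θ s q * chanOverlapAvg π θ s q.1)
        + chanOverlapAvg π θ s q.1 ^ 2 := by ring
  simp only [e3] at h0
  rw [integral_add (hq.integrable_sq.fun_sub (hqa.const_mul 2)) ha.integrable_sq,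
    integral_sub hq.integrable_sq (hqa.const_mul 2), integral_const_mul, e1] at h0
  change 0 ≤ _ - _ + ∫ q, chanOverlapAvg π θ s q.1 ^ 2 ∂h.joint at h0
  rw [e2] at h0
  linarith

/-- The fluctuations of the overlap are controlled by those of the energy. -/
lemma overlap_fluctuations_le (h : BoundedSignal π θ B) (s : Finset ι) :
    ∫ q, (chanOverlap θ s q - ∫ q', chanOverlap θ s q' ∂h.joint) ^ 2 ∂h.joint
      ≤ 4 * ∫ q, (chanEnergy θ s q - ∫ q', chanEnergy θ s q' ∂h.joint) ^ 2 ∂h.joint := by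
  have := h.isProbabilityMeasure_joint
  have hq := h.memLp_overlap s
  have hl := h.memLp_energy s
  have hE := h.integral_energy s
  have hC := h.integral_overlap_mul_energy s
  have hJ := h.integral_overlapAvg_sq_le s
  have hq1 := hq.integrable one_le_two
  set c := ∫ q', chanOverlap θ s q' ∂h.joint with hc
  set d := ∫ q', chanEnergy θ s q' ∂h.joint with hd
  have hqc : MemLp (fun q => chanOverlap θ s q - c) 2 h.joint := hq.sub (memLp_const c)
  have hld : MemLp (fun q => chanEnergy θ s q - d) 2 h.joint := hl.sub (memLp_const d)
  have hql : Integrable (fun q => (chanOverlap θ s q - c) * (chanEnergy θ s q - d)) h.joint :=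
    hqc.integrable_mul hld
  have v1 : ∫ q, (chanOverlap θ s q - c) ^ 2 ∂h.joint
      = ∫ q, chanOverlap θ s q ^ 2 ∂h.joint - c ^ 2 := by
    have e (q : (E × (ι → ℝ)) × E) : (chanOverlap θ s q - c) ^ 2
        = chanOverlap θ s q ^ 2 - (2 * c * chanOverlap θ s q - c ^ 2) := by ring
    simp only [e]
    rw [integral_sub hq.integrable_sq ((hq1.const_mul _).fun_sub (integrable_const _)),
      integral_sub (hq1.const_mul _) (integrable_const _), integral_const_mul, integral_const,
      probReal_univ, one_smul, ← hc]
    ring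
  have v2 : ∫ q, (chanOverlap θ s q - c) * (chanEnergy θ s q - d) ∂h.joint
      = ∫ q, chanOverlap θ s q * chanEnergy θ s q ∂h.joint - c * d := by
    have e (q : (E × (ι → ℝ)) × E) : (chanOverlap θ s q - c) * (chanEnergy θ s q - d)
        = chanOverlap θ s q * chanEnergy θ s q
          - (c * chanEnergy θ s q + d * chanOverlap θ s q - c * d) := by ring
    have hl1 := hl.integrable one_le_two
    have hp : Integrable (fun q => chanOverlap θ s q * chanEnergy θ s q) h.joint :=
      hq.integrable_mul hl
    simp only [e]
    rw [integral_sub hp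
        (((hl1.const_mul _).fun_add (hq1.const_mul _)).fun_sub (integrable_const _)),
      integral_sub ((hl1.const_mul _).fun_add (hq1.const_mul _)) (integrable_const _),
      integral_add (hl1.const_mul _) (hq1.const_mul _), integral_const_mul, integral_const_mul,
      integral_const, probReal_univ, one_smul, ← hc, ← hd]
    ring
  have h0 : 0 ≤ ∫ q, ((chanOverlap θ s q - c) + 2 * (chanEnergy θ s q - d)) ^ 2 ∂h.joint :=
    integral_nonneg fun _ => sq_nonneg _
  have e (q : (E × (ι → ℝ)) × E) :
      ((chanOverlap θ s q - c) + 2 * (chanEnergy θ s q - d)) ^ 2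
        = (chanOverlap θ s q - c) ^ 2 + 4 * ((chanOverlap θ s q - c) * (chanEnergy θ s q - d))
          + 4 * (chanEnergy θ s q - d) ^ 2 := by ring
  simp only [e] at h0
  rw [integral_add (hqc.integrable_sq.fun_add (hql.const_mul 4)) (hld.integrable_sq.const_mul 4),
    integral_add hqc.integrable_sq (hql.const_mul 4), integral_const_mul, integral_const_mul,
    v2, hC, hE] at h0
  rw [hE]
  rw [v1] at h0 ⊢
  nlinarith [h0, hJ]

end BoundedSignal

end Channel

/-! ### The Wigner spike model as a Gaussian channel -/

section WignerSpike

lemma integral_stdGaussPi_sum {κ κ' : Type*} [Fintype κ] [Fintype κ'] {f : (κ ⊕ κ' → ℝ) → ℝ}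
    (hf : Integrable f (stdGaussPi (κ ⊕ κ'))) :
    ∫ w, f w ∂stdGaussPi (κ ⊕ κ')
      = ∫ z, ∫ z', f (Sum.elim z z') ∂stdGaussPi κ' ∂stdGaussPi κ := by
  have hmp := measurePreserving_sumPiEquivProdPi_symm (fun _ : κ ⊕ κ' => stdGauss)
  have h := hmp.integral_comp' f
  have hi := (hmp.integrable_comp_emb (MeasurableEquiv.measurableEmbedding _)).2 hf
  exact h.symm.trans (integral_prod _ hi)

/-- The signal of the interpolating Wigner spike model: the upper triangular part of the rank-one
matrix, followed by the spike itself. -/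
noncomputable def spikeSignal (n : ℕ) (t R : ℝ) (x : Fin n → ℝ) : (Fin n × Fin n) ⊕ Fin n → ℝ :=
  Sum.elim (fun p => if p.1 ≤ p.2 then √((1 - t) / n) * (x p.1 * x p.2) else 0)
    (fun i => √R * x i)

variable {P0 : Measure ℝ} [IsProbabilityMeasure P0] {n : ℕ} {t R S : ℝ}

lemma boundedSignal_spikeSignal (hS : 0 ≤ S) (hsupp : ∀ᵐ x ∂P0, x ∈ Set.Icc (-S) S) :
    BoundedSignal (Measure.pi fun _ : Fin n => P0) (spikeSignal n t R)
      (√((1 - t) / n) * (S * S) + √R * S) := by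
  have ha : 0 ≤ √((1 - t) / n) * (S * S) := by positivity
  have hb : 0 ≤ √R * S := by positivity
  refine ⟨measurable_pi_lambda _ ?_, ?_⟩
  · rintro (p | i)
    · simp only [spikeSignal, Sum.elim_inl]
      split_ifs <;> fun_prop
    · simp only [spikeSignal, Sum.elim_inr]
      fun_prop
  · have h (i : Fin n) : ∀ᵐ x ∂Measure.pi fun _ : Fin n => P0, |x i| ≤ S :=
      (measurePreserving_eval (fun _ : Fin n => P0) i).quasiMeasurePreserving.ae
        (hsupp.mono fun _ hx => abs_le.2 hx)
    filter_upwards [ae_all_iff.2 h] with x hx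
    rintro (p | i)
    · simp only [spikeSignal, Sum.elim_inl]
      split_ifs
      · rw [abs_mul, abs_mul, abs_of_nonneg (Real.sqrt_nonneg _)]
        have := mul_le_mul (hx p.1) (hx p.2) (abs_nonneg _) hS
        have := mul_le_mul_of_nonneg_left this (Real.sqrt_nonneg ((1 - t) / n))
        linarith
      · rw [abs_zero]
        exact add_nonneg ha hb
    · simp only [spikeSignal, Sum.elim_inr]
      rw [abs_mul, abs_of_nonneg (Real.sqrt_nonneg _)]
      have := mul_le_mul_of_nonneg_left (hx i) (Real.sqrt_nonneg R)
      linarith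

lemma chanWt_spikeSignal (hn : 1 ≤ n) (ht : t ≤ 1) (hR : 0 < R) (X x Zt : Fin n → ℝ)
    (Z : Fin n × Fin n → ℝ) :
    chanWt (spikeSignal n t R) x (spikeSignal n t R X + Sum.elim Z Zt)
      = Real.exp (-Hint n t R X Z Zt x) := by
  have hn' : (0 : ℝ) < n := by exact_mod_cast hn
  have ha : √((1 - t) / n) ^ 2 = (1 - t) / n :=
    Real.sq_sqrt (div_nonneg (sub_nonneg.2 ht) hn'.le)
  have ha' : (1 - t) / √(n * (1 - t)) = √((1 - t) / n) := by
    rw [Real.sqrt_mul hn'.le, Real.sqrt_div (sub_nonneg.2 ht), mul_comm, ← div_div, Real.div_sqrt]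
  have hb : √R ^ 2 = R := Real.sq_sqrt hR.le
  have hb' : R / √R = √R := Real.div_sqrt
  rw [chanWt, Hint, Fintype.sum_sum_type, Fintype.sum_prod_type, neg_add, Finset.mul_sum,
    Finset.mul_sum, ← Finset.sum_neg_distrib, ← Finset.sum_neg_distrib]
  congr 2
  · refine Finset.sum_congr rfl fun i _ => ?_
    rw [Finset.sum_filter, Finset.mul_sum, ← Finset.sum_neg_distrib]
    refine Finset.sum_congr rfl fun j _ => ?_
    simp only [spikeSignal, Pi.add_apply, Sum.elim_inl]
    split_ifs
    · trans √((1 - t) / n) ^ 2 * (x i * x j * X i * X j - x i ^ 2 * x j ^ 2 / 2)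
          + √((1 - t) / n) * (x i * x j * Z (i, j))
      · ring
      · nth_rewrite 2 [← ha']
        rw [ha]
        ring
    · simp
  · refine Finset.sum_congr rfl fun i _ => ?_
    simp only [spikeSignal, Pi.add_apply, Sum.elim_inr]
    trans √R ^ 2 * (x i * X i - x i ^ 2 / 2) + √R * (x i * Zt i)
    · ring
    · nth_rewrite 2 [← hb']
      rw [hb]
      ring

lemma gibbsWS_eq_chanAvg (hS : 0 ≤ S) (hsupp : ∀ᵐ x ∂P0, x ∈ Set.Icc (-S) S) (hn : 1 ≤ n)
    (ht : t ≤ 1) (hR : 0 < R) (X Zt : Fin n → ℝ) (Z : Fin n × Fin n → ℝ)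
    (A : (Fin n → ℝ) → ℝ) :
    gibbsWS P0 n t R X Z Zt A = chanAvg (Measure.pi fun _ : Fin n => P0) (spikeSignal n t R) A
      (spikeSignal n t R X + Sum.elim Z Zt) := by
  rw [(boundedSignal_spikeSignal hS hsupp).chanAvg_eq, gibbsWS]
  simp only [chanWt_spikeSignal hn ht hR]

lemma EWS_gibbsWS_eq_integral_joint (hS : 0 ≤ S) (hsupp : ∀ᵐ x ∂P0, x ∈ Set.Icc (-S) S)
    (hn : 1 ≤ n) (ht : t ≤ 1) (hR : 0 < R)
    (h : BoundedSignal (Measure.pi fun _ : Fin n => P0) (spikeSignal n t R)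
      (√((1 - t) / n) * (S * S) + √R * S))
    {A : ((Fin n → ℝ) × ((Fin n × Fin n) ⊕ Fin n → ℝ)) × (Fin n → ℝ) → ℝ}
    (hA : Integrable A h.joint) :
    EWS P0 n (fun X Z Zt => gibbsWS P0 n t R X Z Zt (fun x => A ((X, Sum.elim Z Zt), x)))
      = ∫ q, A q ∂h.joint := by
  have hi := h.integrable_chanAvg_of_joint hA
  rw [h.integral_joint hA, integral_prod _ hi]
  refine integral_congr_ae ?_
  filter_upwards [hi.prod_right_ae] with X hX
  rw [integral_stdGaussPi_sum hX]
  simp only [gibbsWS_eq_chanAvg hS hsupp hn ht hR]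
  rfl

lemma Qws_eq_chanOverlap (hR : 0 < R) (X x : Fin n → ℝ) (w : (Fin n × Fin n) ⊕ Fin n → ℝ) :
    Qws n x X = 1 / (n * R) *
      chanOverlap (spikeSignal n t R) (univ.map Function.Embedding.inr) ((X, w), x) := by
  have hb : √R ^ 2 = R := Real.sq_sqrt hR.le
  simp only [Qws, chanOverlap, Finset.sum_map, Function.Embedding.inr_apply, spikeSignal,
    Sum.elim_inr, Finset.mul_sum]
  refine Finset.sum_congr rfl fun i _ => ?_
  trans 1 / n * (1 / R * √R ^ 2) * (x i * X i)
  · rw [hb, one_div_mul_cancel hR.ne']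
    ring
  · ring

lemma Lws_eq_chanEnergy (hR : 0 < R) (X Zt x : Fin n → ℝ) (Z : Fin n × Fin n → ℝ) :
    Lws n R X Zt x = 1 / (n * R) * chanEnergy (spikeSignal n t R)
      (univ.map Function.Embedding.inr) ((X, Sum.elim Z Zt), x) := by
  have hb : √R ^ 2 = R := Real.sq_sqrt hR.le
  have hb' : √R / R = 1 / √R := Real.sqrt_div_self'
  simp only [Lws, chanEnergy, Finset.sum_map, Function.Embedding.inr_apply, spikeSignal,
    Sum.elim_inr, Finset.mul_sum]
  refine Finset.sum_congr rfl fun i _ => ?_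
  trans 1 / n * ((√R ^ 2 / R) * (x i ^ 2 / 2 - x i * X i) - (√R / R) * (x i * Zt i / 2))
  · rw [hb, hb', div_self hR.ne']
    ring
  · ring

end WignerSpike

/-- The total fluctuations of the overlap are bounded by those of `L`:
`E⟨(Q - E⟨Q⟩)²⟩ ≤ 4 E⟨(L - E⟨L⟩)²⟩` in the interpolating Wigner spike model. -/
theorem wignerSpike_overlap_le_L_fluctuations (S : ℝ) (hS : 0 < S)
    (P0 : Measure ℝ) [IsProbabilityMeasure P0]
    (hsupp : ∀ᵐ x ∂P0, x ∈ Set.Icc (-S) S)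
    (n : ℕ) (hn : 1 ≤ n) (t : ℝ) (ht : t ∈ Set.Icc (0 : ℝ) 1)
    (R : ℝ) (hR : 0 < R) :
    EWS P0 n (fun X Z Zt => gibbsWS P0 n t R X Z Zt
        (fun x => (Qws n x X - EQws P0 n t R) ^ 2))
      ≤ 4 * EWS P0 n (fun X Z Zt => gibbsWS P0 n t R X Z Zt
          (fun x => (Lws n R X Zt x - ELws P0 n t R) ^ 2)) := by
  have h := boundedSignal_spikeSignal (n := n) (t := t) (R := R) hS.le hsupp
  have := h.isProbabilityMeasure_joint
  have hE {A : ((Fin n → ℝ) × ((Fin n × Fin n) ⊕ Fin n → ℝ)) × (Fin n → ℝ) → ℝ}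
      (hA : Integrable A h.joint) :=
    EWS_gibbsWS_eq_integral_joint hS.le hsupp hn ht.2 hR h hA
  have hQ := h.memLp_overlap (univ.map Function.Embedding.inr)
  have hL := h.memLp_energy (univ.map Function.Embedding.inr)
  have hle := h.overlap_fluctuations_le (univ.map Function.Embedding.inr)
  have key {f : ((Fin n → ℝ) × ((Fin n × Fin n) ⊕ Fin n → ℝ)) × (Fin n → ℝ) → ℝ}
      (hf : MemLp f 2 h.joint) (k : ℝ) :
      EWS P0 n (fun X Z Zt => gibbsWS P0 n t R X Z Zt (fun x => (k * f ((X, Sum.elim Z Zt), x)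
        - EWS P0 n (fun X Z Zt => gibbsWS P0 n t R X Z Zt
          (fun x => k * f ((X, Sum.elim Z Zt), x)))) ^ 2))
        = k ^ 2 * ∫ q, (f q - ∫ q', f q' ∂h.joint) ^ 2 ∂h.joint := by
    rw [hE ((hf.integrable one_le_two).const_mul k),
      hE (A := fun q => (k * f q - ∫ q', k * f q' ∂h.joint) ^ 2)
        ((hf.const_mul k).sub (memLp_const _)).integrable_sq,
      ← integral_const_mul]
    refine integral_congr_ae (ae_of_all _ fun q => ?_)
    simp only [integral_const_mul]
    ring
  have kQ := key hQ (1 / (n * R))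
  have kL := key hL (1 / (n * R))
  simp only [← Qws_eq_chanOverlap hR, ← Lws_eq_chanEnergy hR] at kQ kL
  simp only [EQws, ELws]
  rw [kQ, kL]
  exact (mul_le_mul_of_nonneg_left hle (sq_nonneg _)).trans_eq (mul_left_comm _ _ _)
end
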